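/- Let f : (ℂ^n,0) → (ℂ,0) be a germ of holomorphic function of algebraic multiplicity m whose initial homogeneous term f_m has an isolated singularity at the origin (the partial derivatives of f_m have no common zero other than 0). Then the Milnor number of f at the origin satisfies μ_f = (m_f − 1)^n. -/

import Mathlib

open scoped Topology

set_option synthInstance.maxHeartbeats 1000000
set_option maxHeartbeats 1000000

noncomputable section

/-- `ℂⁿ` with the Euclidean norm. -/
abbrev En (n : ℕ) := EuclideanSpace ℂ (Fin n)

instance germAlgebra {α : Type*} (l : Filter α) : Algebra ℂ (Filter.Germ l ℂ) :=
  ((Filter.Germ.coeRingHom l).comp (Pi.constRingHom α ℂ)).toAlgebra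

/-- The ring `𝒪ₙ` of germs at `0` of holomorphic functions on `ℂⁿ`. -/
def AnalyticGerms (n : ℕ) : Subalgebra ℂ ((𝓝 (0 : En n)).Germ ℂ) where
  carrier := {g | ∃ f : En n → ℂ, AnalyticAt ℂ f 0 ∧ g = (f : (𝓝 (0 : En n)).Germ ℂ)}
  add_mem' := by
    rintro a b ⟨f, hf, rfl⟩ ⟨g, hg, rfl⟩
    exact ⟨f + g, hf.add hg, rfl⟩
  mul_mem' := by
    rintro a b ⟨f, hf, rfl⟩ ⟨g, hg, rfl⟩
    exact ⟨f * g, hf.mul hg, rfl⟩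
  algebraMap_mem' := fun c => ⟨fun _ => c, analyticAt_const, rfl⟩

/-- The germ at `0` of the `i`-th partial derivative `∂f/∂zᵢ` of `f`. -/
def partialGerm {n : ℕ} (f : En n → ℂ) (i : Fin n) : (𝓝 (0 : En n)).Germ ℂ :=
  (↑(fun z => fderiv ℂ f z (EuclideanSpace.single i 1)) : (𝓝 (0 : En n)).Germ ℂ)

/-- The Jacobian ideal `⟨∂f/∂z₁, …, ∂f/∂zₙ⟩` of `f` in the ring `𝒪ₙ` of holomorphic
germs at `0`. -/
def jacobianIdeal {n : ℕ} (f : En n → ℂ) : Ideal (AnalyticGerms n) :=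
  Ideal.span {g : AnalyticGerms n | ∃ i : Fin n, (g : (𝓝 (0 : En n)).Germ ℂ) = partialGerm f i}

/-- The Milnor number `μ_f` of `f` at the origin: the complex dimension of
`𝒪ₙ/⟨∂f/∂z₁, …, ∂f/∂zₙ⟩`. -/
def milnorNumber {n : ℕ} (f : En n → ℂ) : ℕ :=
  Module.finrank ℂ ((AnalyticGerms n) ⧸ jacobianIdeal f)

/-- `f` has algebraic multiplicity `ν` with initial homogeneous term `P`:
in the Taylor expansion `f = f_ν + f_{ν+1} + ⋯` of `f` at `0`, the homogeneous
components of degree `< ν` vanish and the one of degree `ν` is `P ≠ 0`. -/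
def HasInitialTerm {n : ℕ} (f : En n → ℂ) (ν : ℕ) (P : En n → ℂ) : Prop :=
  ∃ p : FormalMultilinearSeries ℂ (En n) ℂ, HasFPowerSeriesAt f p 0 ∧
    (∀ k < ν, ∀ z : En n, (p k fun _ => z) = 0) ∧
    (∀ z : En n, P z = p ν fun _ => z) ∧ P ≠ 0

/-- The origin is an isolated singularity of `f`: the gradient of `f` vanishes at `0`
and at no other point of some neighborhood of `0`. -/
def IsolatedSingularityAt0 {n : ℕ} (f : En n → ℂ) : Prop :=
  fderiv ℂ f 0 = 0 ∧ ∃ U ∈ 𝓝 (0 : En n), ∀ z ∈ U, z ≠ 0 → fderiv ℂ f z ≠ 0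

/-- The germs at `0` of the hypersurfaces `V_f = f⁻¹(0)` and `V_g = g⁻¹(0)` are
topologically equisingular: some homeomorphism between neighborhoods of `0`
fixes `0` and sends `f⁻¹(0) ∩ U` onto `g⁻¹(0) ∩ U'`. -/
def TopEquisingular {n : ℕ} (f g : En n → ℂ) : Prop :=
  ∃ U U' : Set (En n), U ∈ 𝓝 (0 : En n) ∧ U' ∈ 𝓝 (0 : En n) ∧
    ∃ φ ψ : En n → En n, φ 0 = 0 ∧ ContinuousOn φ U ∧ ContinuousOn ψ U' ∧
      Set.MapsTo φ U U' ∧ Set.MapsTo ψ U' U ∧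
      (∀ z ∈ U, ψ (φ z) = z) ∧ (∀ z ∈ U', φ (ψ z) = z) ∧
      φ '' (f ⁻¹' {0} ∩ U) = g ⁻¹' {0} ∩ U'

/-- `φ` is a germ of homeomorphism of `(X, 0)`: a homeomorphism between neighborhoods
of `0` fixing `0`. -/
def IsGermHomeoAt0 {X : Type*} [TopologicalSpace X] [Zero X] (φ : X → X) : Prop :=
  ∃ U V : Set X, U ∈ 𝓝 (0 : X) ∧ V ∈ 𝓝 (0 : X) ∧ φ 0 = 0 ∧ ContinuousOn φ U ∧
    Set.MapsTo φ U V ∧ ∃ ψ : X → X, ContinuousOn ψ V ∧ Set.MapsTo ψ V U ∧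
      (∀ x ∈ U, ψ (φ x) = x) ∧ (∀ y ∈ V, φ (ψ y) = y)

/-- `f` and `g` are topologically right-left equivalent:
`f = ψ ∘ g ∘ φ` near `0` for germs of homeomorphisms `φ` of `(ℂⁿ,0)` and `ψ` of `(ℂ,0)`. -/
def TopRightLeftEquiv {n : ℕ} (f g : En n → ℂ) : Prop :=
  ∃ φ : En n → En n, ∃ ψ : ℂ → ℂ, IsGermHomeoAt0 φ ∧ IsGermHomeoAt0 ψ ∧
    ∀ᶠ z in 𝓝 (0 : En n), f z = ψ (g (φ z))

/-- Evaluation of a polynomial in `n` variables at a point of `ℂⁿ`. -/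
def evalE {n : ℕ} (f : MvPolynomial (Fin n) ℂ) : En n → ℂ :=
  fun z => MvPolynomial.eval (fun i => z i) f

section Homogeneous

open MvPolynomial

variable {σ : Type*} {K : Type*} [Field K]

attribute [local instance] MvPolynomial.gradedAlgebra

theorem coe_decompose_homogeneousSubmodule (p : MvPolynomial σ K) (k : ℕ) :
    (DirectSum.decompose (homogeneousSubmodule σ K) p k : MvPolynomial σ K) =
      homogeneousComponent k p :=
  decomposition.decompose'_apply p k

theorem homogeneousComponent_mul_of_le {d k : ℕ} (a : MvPolynomial σ K) {P : MvPolynomial σ K}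
    (hP : P.IsHomogeneous d) :
    homogeneousComponent (k + d) (a * P) = homogeneousComponent k a * P := by
  have := DirectSum.coe_decompose_mul_of_right_mem_of_le (homogeneousSubmodule σ K) (a := a)
    (n := k + d) (i := d) hP (Nat.le_add_left d k)
  rwa [coe_decompose_homogeneousSubmodule, coe_decompose_homogeneousSubmodule,
    Nat.add_sub_cancel] at this

theorem homogeneousComponent_mul_of_lt {d k : ℕ} (a : MvPolynomial σ K) {P : MvPolynomial σ K}
    (hP : P.IsHomogeneous d) (hk : k < d) :
    homogeneousComponent k (a * P) = 0 := by
  have := DirectSum.coe_decompose_mul_of_right_mem_of_not_le (homogeneousSubmodule σ K) (a := a)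
    (n := k) (i := d) hP (by omega)
  rwa [coe_decompose_homogeneousSubmodule] at this

theorem sum_range_homogeneousComponent (p : MvPolynomial σ K) {N : ℕ} (h : p.totalDegree < N) :
    ∑ k ∈ Finset.range N, homogeneousComponent k p = p := by
  conv_rhs => rw [← sum_homogeneousComponent p]
  refine (Finset.sum_subset (Finset.range_mono h) fun k _ hk => ?_).symm
  exact homogeneousComponent_eq_zero _ _ (by simpa [Nat.lt_succ_iff] using hk)

end Homogeneous

section Koszul

variable {ι A : Type*} [CommRing A]

/-- All syzygies of the family `Q` restricted to the finite set `s` are Koszul syzygies. -/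
def HasKoszulSyzygies (Q : ι → A) (s : Finset ι) : Prop :=
  ∀ a : ι → A, ∑ i ∈ s, a i * Q i = 0 →
    ∃ c : ι → ι → A, (∀ i j, c i j = -c j i) ∧ ∀ i ∈ s, a i = ∑ j ∈ s, c i j * Q j

theorem HasKoszulSyzygies.congr {Q Q' : ι → A} {s : Finset ι} (h : HasKoszulSyzygies Q s)
    (hQ : ∀ i ∈ s, Q i = Q' i) : HasKoszulSyzygies Q' s := by
  intro a ha
  obtain ⟨c, hc, hac⟩ := h a (by rw [← ha]; exact Finset.sum_congr rfl fun i hi => by rw [hQ i hi])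
  exact ⟨c, hc, fun i hi => by
    rw [hac i hi]; exact Finset.sum_congr rfl fun j hj => by rw [hQ j hj]⟩

theorem HasKoszulSyzygies.map_ringEquiv {B : Type*} [CommRing B] {Q : ι → A} {s : Finset ι}
    (h : HasKoszulSyzygies Q s) (φ : A ≃+* B) : HasKoszulSyzygies (fun i => φ (Q i)) s := by
  intro a ha
  obtain ⟨c, hc, hac⟩ := h (fun i => φ.symm (a i)) (by
    apply φ.injective
    simpa using ha)
  refine ⟨fun i j => φ (c i j), fun i j => (congrArg _ (hc i j)).trans (map_neg _ _),
    fun i hi => ?_⟩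
  have := congrArg φ (hac i hi)
  simpa using this

theorem hasKoszulSyzygies_empty (Q : ι → A) : HasKoszulSyzygies Q ∅ :=
  fun _ _ => ⟨fun _ _ => 0, by simp, by simp⟩

theorem mem_span_image_finset {Q : ι → A} {s : Finset ι} {y : A} :
    y ∈ Ideal.span (Q '' s) ↔ ∃ a : ι → A, ∑ i ∈ s, a i * Q i = y :=
  Submodule.mem_span_image_finset_iff_exists_fun' A

theorem HasKoszulSyzygies.adjoin [DecidableEq ι] {Q : ι → A} {s : Finset ι} {x : ι} (hx : x ∉ s)
    (h : HasKoszulSyzygies Q s)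
    (hreg : ∀ b, b * Q x ∈ Ideal.span (Q '' s) → b ∈ Ideal.span (Q '' s)) :
    HasKoszulSyzygies Q (insert x s) := by
  intro a ha
  rw [Finset.sum_insert hx] at ha
  obtain ⟨e, he⟩ := mem_span_image_finset.1 (hreg (a x) (mem_span_image_finset.2
    ⟨fun i => -a i, by simp only [neg_mul, Finset.sum_neg_distrib]; linear_combination -ha⟩))
  obtain ⟨c, hc, hac⟩ := h (fun i => a i + e i * Q x) (by
    rw [← ha, ← he, Finset.sum_mul, ← Finset.sum_add_distrib]
    exact Finset.sum_congr rfl fun i _ => by ring)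
  have hne : ∀ i ∈ s, i ≠ x := fun i hi h => hx (h ▸ hi)
  refine ⟨fun i j => if i = x then (if j = x then 0 else e j) else
    if j = x then -e i else c i j, fun i j => ?_, fun i hi => ?_⟩
  · by_cases hi : i = x <;> by_cases hj : j = x <;> simp [hi, hj]
    exact hc i j
  · rw [Finset.sum_insert hx]
    rcases Finset.mem_insert.1 hi with rfl | hi
    · simp only [if_true, zero_mul, zero_add]
      rw [← he]
      exact Finset.sum_congr rfl fun j hj => by simp [hne j hj]
    · simp only [hne i hi, if_false, if_true]
      have : ∑ j ∈ s, (if j = x then -e i else c i j) * Q j = ∑ j ∈ s, c i j * Q j :=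
        Finset.sum_congr rfl fun j hj => by simp [hne j hj]
      rw [this]
      linear_combination hac i hi

theorem HasKoszulSyzygies.mem_span_of_mul_mem [DecidableEq ι] [NoZeroDivisors A] [CharZero A]
    {Q : ι → A} {s : Finset ι} {x : ι} (hx : x ∉ s) (h : HasKoszulSyzygies Q (insert x s)) {b : A}
    (hb : b * Q x ∈ Ideal.span (Q '' s)) : b ∈ Ideal.span (Q '' s) := by
  obtain ⟨a, ha⟩ := mem_span_image_finset.1 hb
  have hne : ∀ i ∈ s, i ≠ x := fun i hi h => hx (h ▸ hi)
  obtain ⟨c, hc, hac⟩ := h (fun i => if i = x then b else -a i) (by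
    rw [Finset.sum_insert hx, if_pos rfl, ← ha, ← Finset.sum_add_distrib]
    exact Finset.sum_eq_zero fun i hi => by simp [hne i hi])
  have := hac x (Finset.mem_insert_self _ _)
  rw [Finset.sum_insert hx, if_pos rfl, self_eq_neg.1 (hc x x), zero_mul, zero_add] at this
  exact mem_span_image_finset.2 ⟨_, this.symm⟩

end Koszul

section KoszulHomogeneous

open MvPolynomial

variable {σ ι : Type*} {K : Type*} [Field K]

theorem HasKoszulSyzygies.exists_homogeneous {d k : ℕ} {Q : ι → MvPolynomial σ K} {s : Finset ι}
    (hQ : ∀ i ∈ s, (Q i).IsHomogeneous d) (h : HasKoszulSyzygies Q s) (a : ι → MvPolynomial σ K)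
    (ha : ∀ i ∈ s, (a i).IsHomogeneous k) (hs : ∑ i ∈ s, a i * Q i = 0) :
    ∃ c : ι → ι → MvPolynomial σ K, (∀ i j, c i j = -c j i) ∧
      (∀ i ∈ s, a i = ∑ j ∈ s, c i j * Q j) ∧ ∀ i j, c i j ≠ 0 →
        d ≤ k ∧ (c i j).IsHomogeneous (k - d) := by
  obtain ⟨c, hc, hac⟩ := h a hs
  have key : ∀ i ∈ s, a i = ∑ j ∈ s, homogeneousComponent k (c i j * Q j) := fun i hi => by
    rw [← map_sum, ← hac i hi, homogeneousComponent_of_mem (ha i hi), if_pos rfl]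
  rcases lt_or_ge k d with hk | hk
  · refine ⟨fun _ _ => 0, by simp, fun i hi => ?_, by simp⟩
    rw [key i hi]
    exact Finset.sum_congr rfl fun j hj => by
      rw [homogeneousComponent_mul_of_lt _ (hQ j hj) hk, zero_mul]
  · obtain ⟨k, rfl⟩ := Nat.exists_eq_add_of_le' hk
    refine ⟨fun i j => homogeneousComponent k (c i j),
      fun i j => (congrArg _ (hc i j)).trans (map_neg _ _),
      fun i hi => ?_, fun i j _ => ⟨hk, by
        simpa using homogeneousComponent_isHomogeneous k (c i j)⟩⟩
    rw [key i hi]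
    exact Finset.sum_congr rfl fun j hj => by rw [homogeneousComponent_mul_of_le _ (hQ j hj)]

theorem HasKoszulSyzygies.of_insert [CharZero K] [DecidableEq ι] {d : ℕ} (hd : 0 < d)
    {Q : ι → MvPolynomial σ K} {s : Finset ι} {x : ι} (hx : x ∉ s)
    (hQ : ∀ i ∈ insert x s, (Q i).IsHomogeneous d) (h : HasKoszulSyzygies Q (insert x s)) :
    HasKoszulSyzygies Q s := by
  have hne : ∀ i ∈ s, i ≠ x := fun i hi h => hx (h ▸ hi)
  have hQs : ∀ i ∈ s, (Q i).IsHomogeneous d := fun i hi => hQ i (Finset.mem_insert_of_mem hi)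
  have hom : ∀ k, ∀ a : ι → MvPolynomial σ K, (∀ i ∈ s, (a i).IsHomogeneous k) →
      ∑ i ∈ s, a i * Q i = 0 → ∃ c : ι → ι → MvPolynomial σ K, (∀ i j, c i j = -c j i) ∧
        ∀ i ∈ s, a i = ∑ j ∈ s, c i j * Q j := by
    intro k
    induction k using Nat.strong_induction_on with
    | _ k ih =>
      intro a ha hs
      obtain ⟨c, hc, hac, hdeg⟩ := h.exists_homogeneous (k := k) hQ
        (fun i => if i = x then 0 else a i) (fun i hi => by
          rcases Finset.mem_insert.1 hi with rfl | hi
          · simpa using isHomogeneous_zero σ K k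
          · simpa [hne i hi] using ha i hi) (by
        rw [Finset.sum_insert hx, if_pos rfl, zero_mul, zero_add, ← hs]
        exact Finset.sum_congr rfl fun i hi => by simp [hne i hi])
      have hxx : ∑ j ∈ s, c x j * Q j = 0 := by
        have := hac x (Finset.mem_insert_self _ _)
        rw [Finset.sum_insert hx, if_pos rfl, self_eq_neg.1 (hc x x), zero_mul, zero_add] at this
        exact this.symm
      rcases lt_or_ge k d with hk | hk
      · have h0 : ∀ i j, c i j = 0 := fun i j => by
          by_contra h0
          exact absurd (hdeg i j h0).1 (by omega)
        refine ⟨fun _ _ => 0, by simp, fun i hi => ?_⟩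
        have := hac i (Finset.mem_insert_of_mem hi)
        simpa [hne i hi, h0] using this
      · obtain ⟨e, he, hce⟩ := ih (k - d) (by omega) (c x) (fun j _ => by
          by_cases h0 : c x j = 0
          · rw [h0]; exact isHomogeneous_zero _ _ _
          · exact (hdeg x j h0).2) hxx
        refine ⟨fun i j => c i j - e i j * Q x,
          fun i j => by linear_combination hc i j - he i j * Q x,
          fun i hi => ?_⟩
        have h1 := hac i (Finset.mem_insert_of_mem hi)
        rw [Finset.sum_insert hx, if_neg (hne i hi), hc i x, hce i hi] at h1
        rw [h1, neg_mul, Finset.sum_mul, neg_add_eq_sub, ← Finset.sum_sub_distrib]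
        exact Finset.sum_congr rfl fun j _ => by ring
  intro a ha
  have hcomp : ∀ k, ∑ i ∈ s, homogeneousComponent k (a i) * Q i = 0 := fun k => by
    have := congrArg (homogeneousComponent (k + d)) ha
    rw [map_sum, map_zero] at this
    rw [← this]
    exact Finset.sum_congr rfl fun i hi => (homogeneousComponent_mul_of_le _ (hQs i hi)).symm
  choose c hc hac using fun k => hom k (fun i => homogeneousComponent k (a i))
    (fun i _ => homogeneousComponent_isHomogeneous _ _) (hcomp k)
  set N := (s.sup fun i => (a i).totalDegree) + 1 with hN
  refine ⟨fun i j => ∑ k ∈ Finset.range N, c k i j, fun i j => ?_, fun i hi => ?_⟩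
  · rw [← Finset.sum_neg_distrib]
    exact Finset.sum_congr rfl fun k _ => hc k i j
  · rw [← sum_range_homogeneousComponent (a i) (N := N)
      (Nat.lt_succ_of_le (Finset.le_sup (f := fun i => (a i).totalDegree) hi))]
    simp_rw [Finset.sum_mul]
    rw [Finset.sum_comm]
    exact Finset.sum_congr rfl fun k _ => hac k i hi

theorem HasKoszulSyzygies.mono [CharZero K] [DecidableEq ι] {d : ℕ} (hd : 0 < d)
    {Q : ι → MvPolynomial σ K} {s t : Finset ι} (hst : s ⊆ t)
    (hQ : ∀ i ∈ t, (Q i).IsHomogeneous d) (h : HasKoszulSyzygies Q t) :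
    HasKoszulSyzygies Q s := by
  obtain ⟨u, rfl⟩ : ∃ u, t = s ∪ u := ⟨t, (Finset.union_eq_right.2 hst).symm⟩
  clear hst
  induction u using Finset.induction_on with
  | empty => rwa [Finset.union_empty] at h
  | insert x u hx ih =>
    rw [Finset.union_insert] at h hQ
    refine ih (fun i hi => hQ i (Finset.mem_insert_of_mem hi)) ?_
    by_cases hxs : x ∈ s ∪ u
    · rwa [Finset.insert_eq_of_mem hxs] at h
    · exact h.of_insert hd hxs hQ

end KoszulHomogeneous

section Exchange

open MvPolynomial

variable {σ : Type*} {K : Type*} [Field K]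

/-- The linear form with the given coefficients. -/
def linearForm [Fintype σ] : (σ → K) →ₗ[K] MvPolynomial σ K := Fintype.linearCombination K X

theorem linearForm_apply [Fintype σ] (c : σ → K) : linearForm c = ∑ j, c j • X j :=
  Fintype.linearCombination_apply K _ c

theorem linearForm_isHomogeneous [Fintype σ] (c : σ → K) : (linearForm c).IsHomogeneous 1 := by
  rw [linearForm_apply]
  exact (homogeneousSubmodule σ K 1).sum_mem fun j _ =>
    (homogeneousSubmodule σ K 1).smul_mem _ (isHomogeneous_X K j)

theorem eval_linearForm [Fintype σ] (c v : σ → K) : eval v (linearForm c) = ∑ j, c j * v j := by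
  simp [linearForm_apply, smul_eval]

/-- The origin is the only common zero of the family `Q`. -/
def OnlyZeroAtOrigin {ι : Type*} (Q : ι → MvPolynomial σ K) : Prop :=
  ∀ v : σ → K, (∀ i, eval v (Q i) = 0) → v = 0

theorem OnlyZeroAtOrigin.ker_eval_le_radical [Finite σ] [IsAlgClosed K] {ι : Type*}
    {Q : ι → MvPolynomial σ K} (hQ : OnlyZeroAtOrigin Q) :
    RingHom.ker (eval (0 : σ → K)) ≤ (Ideal.span (Set.range Q)).radical := by
  intro P hP
  rw [← vanishingIdeal_zeroLocus_eq_radical (K := K)]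
  intro v hv
  have : v = 0 := hQ v fun i => by
    simpa [aeval_eq_eval] using hv (Q i) (Ideal.subset_span ⟨i, rfl⟩)
  simpa [this, aeval_eq_eval] using hP

theorem IsHomogeneous.eval_smul_eq {d : ℕ} {P : MvPolynomial σ K} (hP : P.IsHomogeneous d)
    (t : K) (v : σ → K) : eval (t • v) P = t ^ d * eval v P := by
  rw [eval_eq, eval_eq, Finset.mul_sum]
  refine Finset.sum_congr rfl fun x hx => ?_
  have := hP.degree_eq_sum_deg_support hx
  simp only [Pi.smul_apply, smul_eq_mul, mul_pow, Finset.prod_mul_distrib,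
    Finset.prod_pow_eq_pow_sum]
  rw [this]
  ring

/-- The prime ideal of polynomials vanishing on the line spanned by `v`. -/
def lineIdeal (v : σ → K) : Ideal (MvPolynomial σ K) :=
  RingHom.ker (eval₂Hom Polynomial.C fun j => Polynomial.C (v j) * Polynomial.X)

instance (v : σ → K) : (lineIdeal v).IsPrime := RingHom.ker_isPrime _

theorem mem_lineIdeal_iff [Infinite K] {v : σ → K} {P : MvPolynomial σ K} :
    P ∈ lineIdeal v ↔ ∀ t : K, eval (t • v) P = 0 := by
  have key : ∀ t : K, Polynomial.eval t
      (eval₂Hom Polynomial.C (fun j => Polynomial.C (v j) * Polynomial.X) P) =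
        eval (t • v) P := fun t => by
    induction P using MvPolynomial.induction_on with
    | C a => simp
    | add p q hp hq => simp only [map_add, Polynomial.eval_add, hp, hq]
    | mul_X p j hp => simp only [map_mul, Polynomial.eval_mul, hp]; simp [mul_comm t]
  rw [lineIdeal, RingHom.mem_ker]
  exact ⟨fun h t => by rw [← key, h, Polynomial.eval_zero], fun h =>
    Polynomial.funext fun t => by rw [key, h, Polynomial.eval_zero]⟩

theorem mem_lineIdeal_of_isHomogeneous [Infinite K] {d : ℕ} {P : MvPolynomial σ K}
    (hP : P.IsHomogeneous d) {v : σ → K} (h : eval v P = 0) : P ∈ lineIdeal v :=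
  mem_lineIdeal_iff.2 fun t => by rw [IsHomogeneous.eval_smul_eq hP, h, mul_zero]

theorem lineIdeal_lt_ker_eval [Infinite K] {v : σ → K} (hv : v ≠ 0) :
    lineIdeal v < RingHom.ker (eval (0 : σ → K)) := by
  obtain ⟨j, hj⟩ := Function.ne_iff.1 hv
  refine SetLike.lt_iff_le_and_exists.2 ⟨fun P hP => ?_, X j, by simp, fun h => hj ?_⟩
  · simpa using mem_lineIdeal_iff.1 hP 0
  · simpa using mem_lineIdeal_iff.1 h 1

theorem Ideal.two_le_height_map_of_lt_of_lt {R : Type*} [CommRing R] {p q r : Ideal R} [p.IsPrime]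
    [q.IsPrime] [r.IsPrime] (hpq : p < q) (hqr : q < r) :
    2 ≤ (r.map (Ideal.Quotient.mk p)).height := by
  have hprime : ∀ {s : Ideal R}, p ≤ s → s.IsPrime → (s.map (Ideal.Quotient.mk p)).IsPrime :=
    fun h _ => Ideal.map_isPrime_of_surjective Ideal.Quotient.mk_surjective (by rwa [Ideal.mk_ker])
  have hlt : ∀ {s t : Ideal R}, p ≤ s → s < t →
      s.map (Ideal.Quotient.mk p) < t.map (Ideal.Quotient.mk p) := fun {s t} h hst => by
    refine lt_of_le_of_ne (Ideal.map_mono hst.le) fun he => hst.ne ?_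
    rw [← Ideal.comap_map_mk h, he, Ideal.comap_map_mk (h.trans hst.le)]
  have := hprime le_rfl ‹_›
  have := hprime hpq.le ‹_›
  have := hprime (hpq.trans hqr).le ‹_›
  have h1 := Ideal.height_add_one_le_of_lt_of_isPrime (hlt le_rfl hpq)
  have h2 := Ideal.height_add_one_le_of_lt_of_isPrime (hlt hpq.le hqr)
  calc (2 : ℕ∞) = 0 + 1 + 1 := by norm_num
    _ ≤ _ := (add_le_add_left ((add_le_add_left bot_le _).trans h1) _).trans h2

theorem exists_linearForm_exchange [Fintype σ] [IsAlgClosed K] {ι : Type*} [DecidableEq ι]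
    {d : ℕ} (hd : 0 < d) {Q : ι → MvPolynomial σ K} (hQ : ∀ i, (Q i).IsHomogeneous d)
    (hQ0 : OnlyZeroAtOrigin Q) (x : ι) :
    ∃ c : σ → K, OnlyZeroAtOrigin (Function.update Q x (linearForm c ^ d)) := by
  classical
  have : Infinite K := IsAlgClosed.instInfinite
  set m : Ideal (MvPolynomial σ K) := RingHom.ker (eval (0 : σ → K)) with hm
  have : m.IsPrime := RingHom.ker_isPrime _
  set I : Ideal (MvPolynomial σ K) := Ideal.span (Q '' {i | i ≠ x}) with hI
  have hfin := Ideal.finite_minimalPrimes_of_isNoetherianRing _ I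
  obtain ⟨c, hc⟩ : ∃ c : σ → K, ∀ q ∈ I.minimalPrimes, ¬ m ≤ q → linearForm c ∉ q := by
    have := Subspace.biUnion_ne_univ_of_top_notMem (k := K) (E := σ → K)
      (s := (hfin.toFinset.filter fun q => ¬ m ≤ q).image
        fun q => (q.restrictScalars K).comap linearForm) (by
      simp only [Finset.mem_image, Finset.mem_filter, not_exists, not_and]
      rintro q ⟨-, hq⟩ htop
      refine hq fun P hP => ?_
      have hX : ∀ j, X j ∈ q := fun j => by
        have : Pi.single j 1 ∈ (q.restrictScalars K).comap linearForm := htop ▸ trivial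
        simpa [linearForm_apply, Pi.single_apply] using this
      have h0 : constantCoeff P = 0 := by simpa [hm] using hP
      have hPC : ∀ p : MvPolynomial σ K, p - C (constantCoeff p) ∈ q := fun p => by
        induction p using MvPolynomial.induction_on with
        | C a => simp
        | add p r hp hr =>
          have := q.add_mem hp hr
          rwa [map_add, C_add, add_sub_add_comm]
        | mul_X p j hp => simpa using q.mul_mem_left p (hX j)
      simpa [h0] using hPC P)
    obtain ⟨c, hc⟩ := (Set.ne_univ_iff_exists_notMem _).1 this
    refine ⟨c, fun q hq hmq hcq => hc ?_⟩
    simp only [Set.mem_iUnion]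
    exact ⟨_, Finset.mem_image_of_mem _ (by simpa using ⟨hq, hmq⟩), hcq⟩
  refine ⟨c, fun v hv => ?_⟩
  by_contra hv0
  have hIv : I ≤ lineIdeal v := by
    rw [hI, Ideal.span_le]
    rintro _ ⟨i, hi, rfl⟩
    exact mem_lineIdeal_of_isHomogeneous (hQ i) (by simpa [Function.update_of_ne hi] using hv i)
  have hcv : linearForm c ∈ lineIdeal v :=
    mem_lineIdeal_of_isHomogeneous (linearForm_isHomogeneous c) (by
      have := hv x
      rw [Function.update_self, map_pow] at this
      exact eq_zero_of_pow_eq_zero this)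
  have hlt := lineIdeal_lt_ker_eval hv0
  obtain ⟨q, hq, hqv⟩ := Ideal.exists_minimalPrimes_le hIv
  have hqp : q.IsPrime := hq.1.1
  have hqlt : q < lineIdeal v := lt_of_le_of_ne hqv fun h =>
    hc q hq (hqv.trans_lt hlt).not_ge (h ▸ hcv)
  have hmin : m ∈ (q ⊔ Ideal.span {Q x}).minimalPrimes := by
    refine ⟨⟨inferInstance, sup_le (hqv.trans hlt.le) ?_⟩, fun p ⟨hp, hle⟩ _ => ?_⟩
    · rw [Ideal.span_singleton_le_iff_mem]
      have := IsHomogeneous.eval_smul_eq (hQ x) 0 0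
      simpa [hm, hd.ne'] using this
    · refine hQ0.ker_eval_le_radical.trans ?_
      rw [hp.radical_le_iff, Ideal.span_le]
      rintro _ ⟨i, rfl⟩
      by_cases hi : i = x
      · subst hi
        exact hle (Ideal.mem_sup_right (Ideal.mem_span_singleton_self _))
      · exact hle (Ideal.mem_sup_left (hq.1.2 (Ideal.subset_span ⟨i, hi, rfl⟩)))
  have hle := (Ideal.two_le_height_map_of_lt_of_lt hqlt hlt).trans
    (Ideal.map_height_le_one_of_mem_minimalPrimes hmin)
  exact absurd hle (by decide)

end Exchange

section KoszulOfOnlyZero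

open MvPolynomial

variable {σ : Type*} {K : Type*} [Field K]

theorem span_image_X_pow (d : ℕ) (s : Set σ) :
    Ideal.span ((fun i => (X i : MvPolynomial σ K) ^ d) '' s) =
      Ideal.span ((fun e => monomial e (1 : K)) '' ((fun i => Finsupp.single i d) '' s)) := by
  rw [Set.image_image]
  simp only [X_pow_eq_monomial]

theorem mem_span_X_pow_iff {d : ℕ} {s : Set σ} {p : MvPolynomial σ K} :
    p ∈ Ideal.span ((fun i => (X i : MvPolynomial σ K) ^ d) '' s) ↔
      ∀ e ∈ p.support, ∃ i ∈ s, d ≤ e i := by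
  rw [span_image_X_pow, mem_ideal_span_monomial_image]
  simp [Finsupp.single_le_iff]

theorem hasKoszulSyzygies_X_pow [DecidableEq σ] (d : ℕ) (s : Finset σ) :
    HasKoszulSyzygies (fun i => (X i : MvPolynomial σ K) ^ d) s := by
  induction s using Finset.induction_on with
  | empty => exact hasKoszulSyzygies_empty _
  | insert x s hx ih =>
    refine ih.adjoin hx fun b hb => ?_
    rw [mem_span_X_pow_iff] at hb ⊢
    intro e he
    obtain ⟨i, hi, hle⟩ := hb (e + Finsupp.single x d) (by
      rw [X_pow_eq_monomial, mem_support_iff, coeff_mul_monomial, mul_one]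
      exact mem_support_iff.1 he)
    refine ⟨i, hi, ?_⟩
    rwa [Finsupp.add_apply, Finsupp.single_eq_of_ne (by rintro rfl; exact hx hi), add_zero] at hle

theorem aeval_linearForm [Fintype σ] (c : Matrix σ σ K) (b : σ → K) :
    aeval (fun i => linearForm (c i)) (linearForm b) = linearForm (Matrix.vecMul b c) := by
  rw [linearForm_apply b, map_sum, Matrix.vecMul_eq_sum, map_sum]
  simp

theorem linearForm_single [Fintype σ] [DecidableEq σ] (j : σ) :
    linearForm (Pi.single j (1 : K)) = X j := by
  simp [linearForm_apply, Pi.single_apply]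

theorem aeval_comp_aeval_linearForm [Fintype σ] [DecidableEq σ] {c b : Matrix σ σ K}
    (h : b * c = 1) :
    (aeval (fun i => linearForm (c i))).comp (aeval fun i => linearForm (b i)) =
      AlgHom.id K (MvPolynomial σ K) := by
  refine algHom_ext fun j => ?_
  have : Matrix.vecMul (b j) c = Pi.single j 1 := by
    have := congrFun h j
    rw [Matrix.mul_apply_eq_vecMul] at this
    rw [this]
    funext i
    rw [Matrix.one_apply, Pi.single_apply]
    simp only [eq_comm]
  rw [AlgHom.comp_apply, aeval_X, aeval_linearForm, this, linearForm_single, AlgHom.id_apply]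

theorem hasKoszulSyzygies_linearForm_pow [Fintype σ] [DecidableEq σ] {d : ℕ} (hd : 0 < d)
    (c : Matrix σ σ K) (h : OnlyZeroAtOrigin fun i => linearForm (c i) ^ d) :
    HasKoszulSyzygies (fun i => linearForm (c i) ^ d) Finset.univ := by
  have hc : IsUnit c := by
    rw [← Matrix.mulVec_injective_iff_isUnit]
    refine (injective_iff_map_eq_zero' c.mulVecLin).2 fun v =>
      ⟨fun hv => h v fun i => ?_, fun hv => by rw [hv, map_zero]⟩
    rw [map_pow, eval_linearForm, pow_eq_zero_iff hd.ne']
    exact congrFun hv i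
  have hdet := (Matrix.isUnit_iff_isUnit_det _).1 hc
  have := (hasKoszulSyzygies_X_pow (K := K) d (Finset.univ : Finset σ)).map_ringEquiv
    (AlgEquiv.ofAlgHom _ _ (aeval_comp_aeval_linearForm (Matrix.nonsing_inv_mul c hdet))
      (aeval_comp_aeval_linearForm (Matrix.mul_nonsing_inv c hdet))).toRingEquiv
  simpa using this

theorem OnlyZeroAtOrigin.hasKoszulSyzygies [Fintype σ] [DecidableEq σ] [IsAlgClosed K] [CharZero K]
    {d : ℕ} (hd : 0 < d) {Q : σ → MvPolynomial σ K} (hQ : ∀ i, (Q i).IsHomogeneous d)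
    (h : OnlyZeroAtOrigin Q) : HasKoszulSyzygies Q Finset.univ := by
  suffices H : ∀ (s : Finset σ) (Q : σ → MvPolynomial σ K), (∀ i, (Q i).IsHomogeneous d) →
      OnlyZeroAtOrigin Q → (∀ i ∉ s, ∃ c, Q i = linearForm c ^ d) →
      HasKoszulSyzygies Q Finset.univ from
    H Finset.univ Q hQ h fun i hi => absurd (Finset.mem_univ i) hi
  intro s
  induction s using Finset.induction_on with
  | empty =>
    intro Q hQ h hc
    choose c hc using fun i => hc i (Finset.notMem_empty i)
    obtain rfl : Q = fun i => linearForm (c i) ^ d := funext hc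
    exact hasKoszulSyzygies_linearForm_pow hd c h
  | insert x s hx ih =>
    intro Q hQ h hc
    obtain ⟨c, hl⟩ := exists_linearForm_exchange hd hQ h x
    set Q' := Function.update Q x (linearForm c ^ d) with hQ'
    have hlhom : (linearForm c ^ d).IsHomogeneous d := by
      simpa using (linearForm_isHomogeneous c).pow d
    have hQ'hom : ∀ i, (Q' i).IsHomogeneous d := fun i => by
      by_cases hi : i = x
      · subst hi; simpa [hQ'] using hlhom
      · simpa [hQ', hi] using hQ i
    have hK := ih Q' hQ'hom hl fun i hi => by
      by_cases hix : i = x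
      · subst hix; exact ⟨c, by simp [hQ']⟩
      · obtain ⟨c, h⟩ := hc i (by simp [hix, hi])
        exact ⟨c, by simp [hQ', hix, h]⟩
    have hagree : ∀ i ∈ Finset.univ.erase x, Q' i = Q i := fun i hi => by
      simp [hQ', Finset.ne_of_mem_erase hi]
    have himg : Q' '' (Finset.univ.erase x : Finset σ) = Q '' (Finset.univ.erase x : Finset σ) :=
      Set.image_congr fun i hi => hagree i hi
    have hins : insert x (Finset.univ.erase x) = (Finset.univ : Finset σ) :=
      Finset.insert_erase (Finset.mem_univ x)
    have hxe : x ∉ Finset.univ.erase x := Finset.notMem_erase x _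
    rw [← hins]
    refine ((hK.mono hd (Finset.subset_univ _) fun i _ => hQ'hom i).congr hagree).adjoin hxe ?_
    set I := Ideal.span (Q '' (Finset.univ.erase x : Finset σ)) with hI
    have hreg : ∀ b, b * linearForm c ^ d ∈ I → b ∈ I := fun b hb => by
      have := HasKoszulSyzygies.mem_span_of_mul_mem (Q := Q') (b := b) hxe (by rwa [hins])
      rw [himg] at this
      exact this (by rwa [hQ', Function.update_self])
    obtain ⟨N, hN⟩ := h.ker_eval_le_radical
      (show linearForm c ^ d ∈ RingHom.ker (eval (0 : σ → K)) by
        rw [RingHom.mem_ker, map_pow, eval_linearForm]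
        simp [hd.ne'])
    have hregN : ∀ (N : ℕ) b, b * (linearForm c ^ d) ^ N ∈ I → b ∈ I := fun N => by
      induction N with
      | zero => simp
      | succ N ih => exact fun b hb => ih b (hreg _ (by rwa [mul_assoc, ← pow_succ]))
    rw [← Set.image_univ, ← Finset.coe_univ, ← hins, Finset.coe_insert, Set.image_insert_eq,
      Ideal.mem_span_insert] at hN
    obtain ⟨u, z, hz, hN⟩ := hN
    intro b hb
    refine hregN N b ?_
    rw [hN, mul_add, mul_left_comm]
    exact I.add_mem (I.mul_mem_left _ hb) (I.mul_mem_left _ hz)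

end KoszulOfOnlyZero

section HilbertFunction

open MvPolynomial

variable {σ ι : Type*} {K : Type*} [Field K]

instance [Finite σ] (j : ℕ) : FiniteDimensional K (homogeneousSubmodule σ K j) :=
  Module.Finite.iff_fg.2 (homogeneousSubmodule_fg σ K j)

/-- The homogeneous part of degree `j` of the ideal generated by the `Q i`, `i ∈ s`. -/
def spanDegree (Q : ι → MvPolynomial σ K) (s : Finset ι) (j : ℕ) :
    Submodule K (MvPolynomial σ K) :=
  (Ideal.span (Q '' s)).restrictScalars K ⊓ homogeneousSubmodule σ K j

theorem mem_spanDegree {Q : ι → MvPolynomial σ K} {s : Finset ι} {j : ℕ} {y : MvPolynomial σ K} :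
    y ∈ spanDegree Q s j ↔ y ∈ Ideal.span (Q '' s) ∧ y.IsHomogeneous j := Iff.rfl

theorem mem_spanDegree_add_iff {d : ℕ} {Q : ι → MvPolynomial σ K} {s : Finset ι}
    (hQ : ∀ i, (Q i).IsHomogeneous d) {j : ℕ} {y : MvPolynomial σ K} :
    y ∈ spanDegree Q s (j + d) ↔
      ∃ a : ι → MvPolynomial σ K, (∀ i, (a i).IsHomogeneous j) ∧ ∑ i ∈ s, a i * Q i = y := by
  rw [mem_spanDegree, mem_span_image_finset]
  constructor
  · rintro ⟨⟨a, ha⟩, hy⟩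
    refine ⟨fun i => homogeneousComponent j (a i),
      fun i => homogeneousComponent_isHomogeneous _ _, ?_⟩
    rw [← if_pos (c := j + d = j + d) rfl (t := y) (e := 0), ← homogeneousComponent_of_mem hy, ← ha,
      map_sum]
    exact Finset.sum_congr rfl fun i _ => (homogeneousComponent_mul_of_le _ (hQ i)).symm
  · rintro ⟨a, ha, rfl⟩
    exact ⟨⟨a, rfl⟩, (homogeneousSubmodule σ K _).sum_mem fun i _ => (ha i).mul (hQ i)⟩

theorem spanDegree_of_lt {d : ℕ} {Q : ι → MvPolynomial σ K} {s : Finset ι}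
    (hQ : ∀ i, (Q i).IsHomogeneous d) {j : ℕ} (hj : j < d) : spanDegree Q s j = ⊥ := by
  rw [eq_bot_iff]
  intro y hy
  obtain ⟨hy, hyj⟩ := mem_spanDegree.1 hy
  obtain ⟨a, ha⟩ := mem_span_image_finset.1 hy
  have := homogeneousComponent_of_mem (m := j) hyj
  rw [if_pos rfl, ← ha, map_sum] at this
  rw [Submodule.mem_bot, ← ha, ← this]
  exact Finset.sum_eq_zero fun i _ => homogeneousComponent_mul_of_lt _ (hQ i) hj

theorem finrank_spanDegree_insert [Finite σ] [DecidableEq ι] [CharZero K] {d : ℕ}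
    {Q : ι → MvPolynomial σ K} (hd : 0 < d) (hQ : ∀ i, (Q i).IsHomogeneous d) {s : Finset ι} {x : ι}
    (hx : x ∉ s) (h : HasKoszulSyzygies Q (insert x s)) (j : ℕ) :
    Module.finrank K (spanDegree Q (insert x s) (j + d)) + Module.finrank K (spanDegree Q s j) =
      Module.finrank K (homogeneousSubmodule σ K j) +
        Module.finrank K (spanDegree Q s (j + d)) := by
  have hreg : ∀ b, b * Q x ∈ Ideal.span (Q '' s) → b ∈ Ideal.span (Q '' s) :=
    fun b hb => h.mem_span_of_mul_mem hx hb
  have hQ0 : Q x ≠ 0 := fun h0 => by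
    have h1 := hreg 1 (by rw [h0, mul_zero]; exact zero_mem _)
    have : Ideal.span (Q '' s) ≤ RingHom.ker (eval (0 : σ → K)) := by
      rw [Ideal.span_le]
      rintro _ ⟨i, -, rfl⟩
      have := IsHomogeneous.eval_smul_eq (hQ i) 0 0
      simpa [hd.ne'] using this
    simpa using this h1
  have hinj : Function.Injective (LinearMap.mulRight K (Q x)) := mul_left_injective₀ hQ0
  have hsup : spanDegree Q (insert x s) (j + d) =
      (homogeneousSubmodule σ K j).map (LinearMap.mulRight K (Q x)) ⊔ spanDegree Q s (j + d) := by
    ext y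
    rw [mem_spanDegree_add_iff hQ, Submodule.mem_sup]
    constructor
    · rintro ⟨a, ha, rfl⟩
      exact ⟨_, ⟨a x, ha x, rfl⟩, _, (mem_spanDegree_add_iff hQ).2 ⟨a, ha, rfl⟩,
        (Finset.sum_insert hx).symm⟩
    · rintro ⟨_, ⟨b, hb, rfl⟩, z, hz, rfl⟩
      obtain ⟨a, ha, rfl⟩ := (mem_spanDegree_add_iff hQ).1 hz
      refine ⟨Function.update a x b, fun i => ?_, ?_⟩
      · by_cases hi : i = x
        · subst hi; simpa using hb
        · simpa [hi] using ha i
      · rw [Finset.sum_insert hx, Function.update_self]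
        refine congrArg _ (Finset.sum_congr rfl fun i hi => ?_)
        rw [Function.update_of_ne (by rintro rfl; exact hx hi)]
  have hinf : (homogeneousSubmodule σ K j).map (LinearMap.mulRight K (Q x)) ⊓
      spanDegree Q s (j + d) = (spanDegree Q s j).map (LinearMap.mulRight K (Q x)) := by
    ext y
    constructor
    · rintro ⟨⟨b, hb, rfl⟩, hy⟩
      exact ⟨b, ⟨hreg b hy.1, hb⟩, rfl⟩
    · rintro ⟨b, hb, rfl⟩
      exact ⟨⟨b, hb.2, rfl⟩, Ideal.mul_mem_right _ _ hb.1, IsHomogeneous.mul hb.2 (hQ x)⟩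
  have hfin : ∀ s k, FiniteDimensional K (spanDegree Q s k) := fun s k =>
    Submodule.finiteDimensional_of_le inf_le_right
  have := hfin s (j + d)
  rw [(Submodule.equivMapOfInjective _ hinj (spanDegree Q s j)).finrank_eq,
    (Submodule.equivMapOfInjective _ hinj (homogeneousSubmodule σ K j)).finrank_eq, hsup, ← hinf]
  exact Submodule.finrank_sup_add_finrank_inf_eq _ _

theorem finrank_spanDegree_eq [Finite σ] [DecidableEq ι] [CharZero K] {d : ℕ} (hd : 0 < d)
    {Q Q' : ι → MvPolynomial σ K} (hQ : ∀ i, (Q i).IsHomogeneous d)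
    (hQ' : ∀ i, (Q' i).IsHomogeneous d) {s : Finset ι} (h : HasKoszulSyzygies Q s)
    (h' : HasKoszulSyzygies Q' s) (j : ℕ) :
    Module.finrank K (spanDegree Q s j) = Module.finrank K (spanDegree Q' s j) := by
  induction s using Finset.induction_on generalizing j with
  | empty =>
    have : spanDegree Q ∅ j = spanDegree Q' ∅ j := by
      simp [spanDegree, Finset.coe_empty, Set.image_empty]
    rw [this]
  | insert x s hx ih =>
    have ih := ih (h.of_insert hd hx fun i _ => hQ i) (h'.of_insert hd hx fun i _ => hQ' i)
    rcases lt_or_ge j d with hj | hj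
    · rw [spanDegree_of_lt hQ hj, spanDegree_of_lt hQ' hj]
    · obtain ⟨j, rfl⟩ := Nat.exists_eq_add_of_le' hj
      have h1 := finrank_spanDegree_insert hd hQ hx h j
      have h2 := finrank_spanDegree_insert hd hQ' hx h' j
      have h3 := ih j
      have h4 := ih (j + d)
      omega

theorem finrank_spanDegree_X_pow [Fintype σ] [DecidableEq σ] (d j : ℕ) :
    Module.finrank K (spanDegree (fun i => (X i : MvPolynomial σ K) ^ d) Finset.univ j) +
      Fintype.card {α : σ → Fin d // ∑ i, (α i : ℕ) = j} =
        Module.finrank K (homogeneousSubmodule σ K j) := by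
  let T := {α : σ → Fin d // ∑ i, (α i : ℕ) = j}
  let toExp : T → (σ →₀ ℕ) := fun α => Finsupp.equivFunOnFinite.symm fun i => (α.1 i : ℕ)
  have hexp : Function.Injective toExp := fun α β h => Subtype.ext <| funext fun i =>
    Fin.ext (by simpa [toExp] using DFunLike.congr_fun h i)
  let L : MvPolynomial σ K →ₗ[K] (T → K) := LinearMap.pi fun α => lcoeff K (toExp α)
  have hL : ∀ p α, L p α = coeff (toExp α) p := fun p α => rfl
  have hrange : (L.domRestrict (homogeneousSubmodule σ K j)).range = ⊤ := by
    rw [LinearMap.range_eq_top]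
    intro u
    refine ⟨⟨∑ α, monomial (toExp α) (u α), Submodule.sum_mem _ fun α _ => ?_⟩, ?_⟩
    · refine isHomogeneous_monomial _ ?_
      rw [Finsupp.degree_eq_sum]
      exact α.2
    · funext α
      rw [LinearMap.domRestrict_apply, hL]
      simp [coeff_sum, coeff_monomial, hexp.eq_iff]
  have hker : (L.domRestrict (homogeneousSubmodule σ K j)).ker.map
      (homogeneousSubmodule σ K j).subtype =
        spanDegree (fun i => (X i : MvPolynomial σ K) ^ d) Finset.univ j := by
    rw [LinearMap.domRestrict, LinearMap.ker_comp, Submodule.map_comap_subtype, inf_comm]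
    ext p
    rw [mem_spanDegree, mem_span_X_pow_iff]
    refine and_congr_left fun hp => ?_
    change L p = 0 ↔ _
    constructor
    · intro h e he
      by_contra! hcon
      refine mem_support_iff.1 he ?_
      have := congrFun h ⟨fun i => ⟨e i, hcon i (by simp)⟩, by
        have := hp.degree_eq_sum_deg_support he
        exact (Finsupp.degree_eq_sum e).symm.trans this.symm⟩
      rw [hL, Pi.zero_apply] at this
      convert this
      ext i
      simp [toExp]
    · intro h
      funext α
      rw [hL]
      by_contra hne
      obtain ⟨i, -, hi⟩ := h _ (mem_support_iff.2 hne)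
      have := (α.1 i).2
      simp [toExp] at hi
      omega
  have := LinearMap.finrank_range_add_finrank_ker (L.domRestrict (homogeneousSubmodule σ K j))
  rw [hrange, finrank_top, Module.finrank_fintype_fun_eq_card, ← Submodule.finrank_map_subtype_eq,
    hker] at this
  rw [← this, add_comm]

theorem sum_card_fin_functions [Fintype σ] [DecidableEq σ] (d : ℕ) {N : ℕ}
    (hN : Fintype.card σ * d < N) :
    ∑ j ∈ Finset.range N, Fintype.card {α : σ → Fin d // ∑ i, (α i : ℕ) = j} =
      d ^ Fintype.card σ := by
  have := Finset.card_eq_sum_card_fiberwise (s := (Finset.univ : Finset (σ → Fin d)))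
    (t := Finset.range N) (f := fun α => ∑ i, (α i : ℕ)) (fun α _ => by
      have : ∑ i, (α i : ℕ) ≤ ∑ _i : σ, d := Finset.sum_le_sum fun i _ => (α i).2.le
      simp at this ⊢
      omega)
  rw [Finset.card_univ, Fintype.card_fun, Fintype.card_fin] at this
  rw [this]
  exact Finset.sum_congr rfl fun j _ => Fintype.card_subtype _

theorem OnlyZeroAtOrigin.finrank_spanDegree [Fintype σ] [DecidableEq σ] [IsAlgClosed K]
    [CharZero K] {d : ℕ} (hd : 0 < d) {Q : σ → MvPolynomial σ K} (hQ : ∀ i, (Q i).IsHomogeneous d)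
    (h : OnlyZeroAtOrigin Q) (j : ℕ) :
    Module.finrank K (spanDegree Q Finset.univ j) +
      Fintype.card {α : σ → Fin d // ∑ i, (α i : ℕ) = j} =
        Module.finrank K (homogeneousSubmodule σ K j) := by
  rw [finrank_spanDegree_eq hd hQ (Q' := fun i => X i ^ d) (fun i => by
    simpa using (isHomogeneous_X K i).pow d) (h.hasKoszulSyzygies hd hQ)
    (hasKoszulSyzygies_X_pow d _), finrank_spanDegree_X_pow]

end HilbertFunction

section LocalStep

theorem self_eq_neg_of_charZero (K : Type*) [Field K] [CharZero K] {V : Type*} [AddCommGroup V]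
    [Module K V] {v : V} : v = -v ↔ v = 0 := by
  refine ⟨fun h => ?_, fun h => by rw [h, neg_zero]⟩
  have h2 : (2 : K) • v = 0 := by rw [two_smul, add_eq_zero_iff_eq_neg]; exact h
  exact (smul_eq_zero.1 h2).resolve_left two_ne_zero

open MvPolynomial

variable {σ : Type*} {K : Type*} [Field K] {R : Type*} [CommRing R] [Algebra K R]

theorem finrank_quotient_add_finrank_comap {E : Type*} [AddCommGroup E] [Module K E]
    [FiniteDimensional K E] (φ : E →ₗ[K] R) {A' A : Ideal R} (hle : A' ≤ A)
    (hφ : ∀ e, φ e ∈ A) (hA : ∀ a ∈ A, ∃ e, a - φ e ∈ A') [FiniteDimensional K (R ⧸ A)] :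
    FiniteDimensional K (R ⧸ A') ∧
      Module.finrank K (R ⧸ A') + Module.finrank K ((A'.restrictScalars K).comap φ) =
        Module.finrank K (R ⧸ A) + Module.finrank K E := by
  let π : (R ⧸ A') →ₗ[K] R ⧸ A := (Ideal.Quotient.factorₐ K hle).toLinearMap
  let χ : E →ₗ[K] R ⧸ A' := (Ideal.Quotient.mkₐ K A').toLinearMap ∘ₗ φ
  have hχ : ∀ e, χ e = Ideal.Quotient.mk A' (φ e) := fun _ => rfl
  have hπ : ∀ a, π (Ideal.Quotient.mk A' a) = Ideal.Quotient.mk A a := fun _ => rfl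
  have hkerχ : χ.ker = (A'.restrictScalars K).comap φ := by
    ext e
    rw [LinearMap.mem_ker, hχ, Ideal.Quotient.eq_zero_iff_mem]
    rfl
  have hkerπ : π.ker = χ.range := by
    ext y
    obtain ⟨a, rfl⟩ := Ideal.Quotient.mk_surjective y
    rw [LinearMap.mem_ker, hπ, Ideal.Quotient.eq_zero_iff_mem, LinearMap.mem_range]
    constructor
    · intro ha
      obtain ⟨e, he⟩ := hA a ha
      exact ⟨e, ((Ideal.Quotient.mk_eq_mk_iff_sub_mem _ _).2 he).symm⟩
    · rintro ⟨e, he⟩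
      rw [hχ, Ideal.Quotient.mk_eq_mk_iff_sub_mem] at he
      simpa using A.sub_mem (hφ e) (hle he)
  have hsurj : Function.Surjective π := fun y => by
    obtain ⟨a, rfl⟩ := Ideal.Quotient.mk_surjective y
    exact ⟨_, hπ a⟩
  have hfin : FiniteDimensional K (R ⧸ A') := by
    have h1 : FiniteDimensional K π.ker := by rw [hkerπ]; infer_instance
    have h2 : FiniteDimensional K ((R ⧸ A') ⧸ π.ker) :=
      Module.Finite.equiv (π.quotKerEquivOfSurjective hsurj).symm
    exact Module.Finite.of_submodule_quotient π.ker
  refine ⟨hfin, ?_⟩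
  have h1 := π.finrank_range_add_finrank_ker
  have h2 := χ.finrank_range_add_finrank_ker
  rw [LinearMap.range_eq_top.2 hsurj, finrank_top, hkerπ] at h1
  rw [hkerχ] at h2
  omega

theorem MvPolynomial.IsHomogeneous.map_mem_pow {q : MvPolynomial σ K} {k : ℕ}
    (hq : q.IsHomogeneous k) (ψ : MvPolynomial σ K →ₐ[K] R) {𝔪 : Ideal R}
    (h : ∀ i, ψ (X i) ∈ 𝔪) : ψ q ∈ 𝔪 ^ k := by
  rw [q.as_sum, map_sum]
  refine Ideal.sum_mem _ fun e he => ?_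
  rw [monomial_eq, map_mul, map_finsuppProd]
  refine Ideal.mul_mem_left _ _ ?_
  rw [hq.degree_eq_sum_deg_support he, ← Finset.prod_pow_eq_pow_sum]
  refine Ideal.prod_mem_prod fun i _ => ?_
  simp only [map_pow]
  exact Ideal.pow_mem_pow (h i) _

/-- The ideal `𝔪` of `R` is generated by the images under `ψ` of the variables, has residue ring
`K`, lies in the Jacobson radical, and its associated graded ring is a polynomial ring. -/
structure IsRegularSystem (ψ : MvPolynomial σ K →ₐ[K] R) (𝔪 : Ideal R) : Prop where
  eq_span : 𝔪 = Ideal.span (Set.range fun i => ψ (X i))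
  exists_const : ∀ a, ∃ c : K, a - algebraMap K R c ∈ 𝔪
  eq_zero_of_mem : ∀ {k : ℕ} {q : MvPolynomial σ K}, q.IsHomogeneous k → ψ q ∈ 𝔪 ^ (k + 1) → q = 0
  le_jacobson : 𝔪 ≤ Ideal.jacobson ⊥

namespace IsRegularSystem

variable {ψ : MvPolynomial σ K →ₐ[K] R} {𝔪 : Ideal R}

theorem map_mem (h : IsRegularSystem ψ 𝔪) {k : ℕ} {q : MvPolynomial σ K} (hq : q.IsHomogeneous k) :
    ψ q ∈ 𝔪 ^ k :=
  hq.map_mem_pow ψ fun i => h.eq_span ▸ Ideal.subset_span ⟨i, rfl⟩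

theorem exists_isHomogeneous_one [Fintype σ] (h : IsRegularSystem ψ 𝔪) {a : R} (ha : a ∈ 𝔪) :
    ∃ q : MvPolynomial σ K, q.IsHomogeneous 1 ∧ a - ψ q ∈ 𝔪 ^ 2 := by
  have hX : ∀ i, ψ (X i) ∈ 𝔪 := fun i => h.eq_span ▸ Ideal.subset_span ⟨i, rfl⟩
  rw [h.eq_span] at ha
  obtain ⟨b, rfl⟩ := Ideal.mem_span_range_iff_exists_fun.1 ha
  choose c hc using fun i => h.exists_const (b i)
  refine ⟨linearForm c, linearForm_isHomogeneous c, ?_⟩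
  rw [linearForm_apply, map_sum, ← Finset.sum_sub_distrib]
  refine Ideal.sum_mem _ fun i _ => ?_
  rw [map_smul, Algebra.smul_def, ← sub_mul, sq]
  exact Ideal.mul_mem_mul (hc i) (hX i)

theorem exists_isHomogeneous [Fintype σ] (h : IsRegularSystem ψ 𝔪) {k : ℕ} {a : R}
    (ha : a ∈ 𝔪 ^ k) : ∃ q : MvPolynomial σ K, q.IsHomogeneous k ∧ a - ψ q ∈ 𝔪 ^ (k + 1) := by
  induction k generalizing a with
  | zero =>
    obtain ⟨c, hc⟩ := h.exists_const a
    exact ⟨C c, isHomogeneous_C _ _, by simpa [← algebraMap_eq] using hc⟩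
  | succ k ih =>
    rw [pow_succ] at ha
    induction ha using Submodule.mul_induction_on' with
    | mem_mul_mem b hb y hy =>
      obtain ⟨q, hq, hbq⟩ := ih hb
      obtain ⟨r, hr, hyr⟩ := h.exists_isHomogeneous_one hy
      refine ⟨q * r, hq.mul hr, ?_⟩
      have : b * y - ψ (q * r) = (b - ψ q) * y + ψ q * (y - ψ r) := by rw [map_mul]; ring
      rw [this]
      refine Ideal.add_mem _ ?_ ?_
      · rw [pow_succ]
        exact Ideal.mul_mem_mul hbq hy
      · rw [add_assoc, pow_add]
        exact Ideal.mul_mem_mul (h.map_mem hq) hyr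
    | add b _ y _ hb hy =>
      obtain ⟨q, hq, hbq⟩ := hb
      obtain ⟨r, hr, hyr⟩ := hy
      refine ⟨q + r, hq.add hr, ?_⟩
      rw [map_add, add_sub_add_comm]
      exact Ideal.add_mem _ hbq hyr

variable [Fintype σ] {d : ℕ} {Q : σ → MvPolynomial σ K} {g : σ → R}

theorem sum_mul_sub_map_mem_pow (h : IsRegularSystem ψ 𝔪)
    (hg : ∀ i, g i - ψ (Q i) ∈ 𝔪 ^ (d + 1)) {k : ℕ} {a : σ → MvPolynomial σ K}
    (ha : ∀ i, (a i).IsHomogeneous k) :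
    ∑ i, ψ (a i) * g i - ψ (∑ i, a i * Q i) ∈ 𝔪 ^ (k + d + 1) := by
  rw [map_sum, ← Finset.sum_sub_distrib]
  refine Ideal.sum_mem _ fun i _ => ?_
  rw [map_mul, ← mul_sub, add_assoc, pow_add]
  exact Ideal.mul_mem_mul (h.map_mem (ha i)) (hg i)

theorem pow_le_span [IsAlgClosed K] (h : IsRegularSystem ψ 𝔪) (hQ : ∀ i, (Q i).IsHomogeneous d)
    (hQ0 : OnlyZeroAtOrigin Q) (hg : ∀ i, g i - ψ (Q i) ∈ 𝔪 ^ (d + 1)) :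
    ∃ M, ∀ N ≥ M, 𝔪 ^ N ≤ Ideal.span (Set.range g) := by
  obtain ⟨M, hM⟩ := Ideal.exists_pow_le_of_le_radical_of_fg hQ0.ker_eval_le_radical
    (IsNoetherian.noetherian _)
  refine ⟨M + d, fun N hN => ?_⟩
  obtain ⟨k, rfl⟩ := Nat.exists_eq_add_of_le' (show d ≤ N by omega)
  have hfg : (𝔪 ^ (k + d)).FG := by
    rw [h.eq_span]
    exact Ideal.FG.pow (Submodule.fg_span (Set.finite_range _))
  refine Submodule.le_of_le_smul_of_le_jacobson_bot hfg h.le_jacobson fun a ha => ?_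
  obtain ⟨q, hq, haq⟩ := h.exists_isHomogeneous ha
  have hqI : q ∈ spanDegree Q Finset.univ (k + d) := by
    refine ⟨?_, hq⟩
    have := hM (Ideal.pow_le_pow_right (show M ≤ k + d by omega)
      (hq.map_mem_pow (AlgHom.id K _) (𝔪 := RingHom.ker (eval (0 : σ → K))) fun i => by simp))
    simpa using this
  obtain ⟨α, hα, rfl⟩ := (mem_spanDegree_add_iff hQ).1 hqI
  have h1 := h.sum_mul_sub_map_mem_pow hg hα
  have h2 : ∑ i, ψ (α i) * g i ∈ Ideal.span (Set.range g) :=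
    Ideal.sum_mem _ fun i _ => Ideal.mul_mem_left _ _ (Ideal.subset_span ⟨i, rfl⟩)
  rw [smul_eq_mul, ← pow_succ']
  have := Submodule.add_mem_sup h2 (Ideal.sub_mem _ haq h1)
  convert this using 1
  ring

theorem mem_span_of_map_mem [CharZero K] (h : IsRegularSystem ψ 𝔪)
    (hQ : ∀ i, (Q i).IsHomogeneous d) (hK : HasKoszulSyzygies Q Finset.univ)
    (hg : ∀ i, g i - ψ (Q i) ∈ 𝔪 ^ (d + 1)) {j : ℕ} {q : MvPolynomial σ K}
    (hq : q.IsHomogeneous j) (hqJ : ψ q ∈ 𝔪 ^ (j + 1) ⊔ Ideal.span (Set.range g)) :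
    q ∈ Ideal.span (Set.range Q) := by
  have hgd : ∀ i, g i ∈ 𝔪 ^ d := fun i => by
    have := Ideal.add_mem _ (Ideal.pow_le_pow_right d.le_succ (hg i)) (h.map_mem (hQ i))
    rwa [sub_add_cancel] at this
  suffices H : ∀ (t k : ℕ), j + 1 ≤ k + t → ∀ a : σ → R, (∀ i, a i ∈ 𝔪 ^ k) →
      ψ q - ∑ i, a i * g i ∈ 𝔪 ^ (j + 1) → q ∈ Ideal.span (Set.range Q) by
    obtain ⟨u, hu, v, hv, huv⟩ := Submodule.mem_sup.1 hqJ
    obtain ⟨a, rfl⟩ := Ideal.mem_span_range_iff_exists_fun.1 hv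
    refine H (j + 1) 0 (by omega) a (fun i => by simp) ?_
    rwa [← huv, add_sub_cancel_right]
  have hzero : ∀ k, j < k + d → ∀ a : σ → R, (∀ i, a i ∈ 𝔪 ^ k) →
      ψ q - ∑ i, a i * g i ∈ 𝔪 ^ (j + 1) → q ∈ Ideal.span (Set.range Q) := by
    intro k hk a ha hqa
    have h1 : ∑ i, a i * g i ∈ 𝔪 ^ (j + 1) := Ideal.pow_le_pow_right hk
      (Ideal.sum_mem _ fun i _ => by rw [pow_add]; exact Ideal.mul_mem_mul (ha i) (hgd i))
    have h2 := Ideal.add_mem _ hqa h1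
    rw [sub_add_cancel] at h2
    rw [h.eq_zero_of_mem hq h2]
    exact zero_mem _
  intro t
  induction t with
  | zero => exact fun k hk => hzero k (by omega)
  | succ t ih =>
    intro k hk a ha hqa
    rcases lt_or_ge j (k + d) with hjk | hjk
    · exact hzero k hjk a ha hqa
    choose α hα haα using fun i => h.exists_isHomogeneous (ha i)
    have hs : (∑ i, α i * Q i).IsHomogeneous (k + d) :=
      (homogeneousSubmodule σ K _).sum_mem fun i _ => (hα i).mul (hQ i)
    have hdiff : ∑ i, a i * g i - ψ (∑ i, α i * Q i) ∈ 𝔪 ^ (k + d + 1) := by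
      have h1 : ∑ i, (a i - ψ (α i)) * g i ∈ 𝔪 ^ (k + d + 1) := Ideal.sum_mem _ fun i _ => by
        rw [add_right_comm, pow_add]
        exact Ideal.mul_mem_mul (haα i) (hgd i)
      have h2 := Ideal.add_mem _ h1 (h.sum_mul_sub_map_mem_pow hg hα)
      convert h2 using 1
      simp only [sub_mul, Finset.sum_sub_distrib]
      ring
    rcases hjk.eq_or_lt with rfl | hjk
    · have h1 := Ideal.add_mem _ hqa hdiff
      rw [sub_add_sub_cancel, ← map_sub] at h1
      rw [sub_eq_zero.1 (h.eq_zero_of_mem (hq.sub hs) h1)]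
      exact Ideal.sum_mem _ fun i _ => Ideal.mul_mem_left _ _ (Ideal.subset_span ⟨i, rfl⟩)
    · have h1 : ψ (∑ i, α i * Q i) ∈ 𝔪 ^ (k + d + 1) := by
        have h2 := Ideal.sub_mem _ (Ideal.pow_le_pow_right hjk (h.map_mem hq))
          (Ideal.add_mem _ (Ideal.pow_le_pow_right (show k + d + 1 ≤ j + 1 by omega) hqa) hdiff)
        convert h2 using 1
        ring
      obtain ⟨c, hc, hαc, hdeg⟩ := hK.exists_homogeneous (fun i _ => hQ i) α (fun i _ => hα i)
        (h.eq_zero_of_mem hs h1)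
      have hanti : ∑ i, (∑ l, ψ (c i l) * g l) * g i = 0 := by
        refine (self_eq_neg_of_charZero K).1 ?_
        conv_lhs =>
          simp only [Finset.sum_mul]
          rw [Finset.sum_comm]
        rw [← Finset.sum_neg_distrib]
        refine Finset.sum_congr rfl fun i _ => ?_
        rw [Finset.sum_mul, ← Finset.sum_neg_distrib]
        refine Finset.sum_congr rfl fun l _ => ?_
        rw [hc l i, map_neg]
        ring
      refine ih (k + 1) (by omega) (fun i => a i - ∑ l, ψ (c i l) * g l) (fun i => ?_) ?_
      · have h3 : ∑ l, ψ (c i l) * (g l - ψ (Q l)) ∈ 𝔪 ^ (k + 1) := Ideal.sum_mem _ fun l _ => by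
          by_cases h0 : c i l = 0
          · simp [h0]
          · obtain ⟨hdk, hcl⟩ := hdeg i l h0
            have := Ideal.mul_mem_mul (h.map_mem hcl) (hg l)
            rwa [← pow_add, show k - d + (d + 1) = k + 1 by omega] at this
        have h4 := Ideal.sub_mem _ (haα i) h3
        convert h4 using 1
        rw [hαc i (Finset.mem_univ i), map_sum]
        simp only [mul_sub, Finset.sum_sub_distrib, map_mul]
        ring
      · simpa only [sub_mul, Finset.sum_sub_distrib, hanti, sub_zero] using hqa

theorem finrank_quotient_eq [IsAlgClosed K] [CharZero K] (h : IsRegularSystem ψ 𝔪) (hd : 0 < d)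
    (hQ : ∀ i, (Q i).IsHomogeneous d) (hQ0 : OnlyZeroAtOrigin Q)
    (hg : ∀ i, g i - ψ (Q i) ∈ 𝔪 ^ (d + 1)) :
    Module.finrank K (R ⧸ Ideal.span (Set.range g)) = d ^ Fintype.card σ := by
  classical
  set J := Ideal.span (Set.range g) with hJ
  have hK := hQ0.hasKoszulSyzygies hd hQ
  have key : ∀ j, FiniteDimensional K (R ⧸ (𝔪 ^ j ⊔ J)) ∧
      Module.finrank K (R ⧸ (𝔪 ^ j ⊔ J)) = ∑ l ∈ Finset.range j,
        Fintype.card {α : σ → Fin d // ∑ i, (α i : ℕ) = l} := by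
    intro j
    induction j with
    | zero =>
      have : Subsingleton (R ⧸ (𝔪 ^ 0 ⊔ J)) := by
        rw [Ideal.Quotient.subsingleton_iff]
        simp
      exact ⟨inferInstance, by simp [Module.finrank_zero_of_subsingleton]⟩
    | succ j ih =>
      have := ih.1
      obtain ⟨hfin, heq⟩ := finrank_quotient_add_finrank_comap
        (ψ.toLinearMap ∘ₗ (homogeneousSubmodule σ K j).subtype)
        (A' := 𝔪 ^ (j + 1) ⊔ J) (A := 𝔪 ^ j ⊔ J)
        (sup_le_sup_right (Ideal.pow_le_pow_right j.le_succ) _)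
        (fun e => Ideal.mem_sup_left (h.map_mem e.2)) fun a ha => by
          obtain ⟨u, hu, v, hv, rfl⟩ := Submodule.mem_sup.1 ha
          obtain ⟨q, hq, huq⟩ := h.exists_isHomogeneous hu
          refine ⟨⟨q, hq⟩, ?_⟩
          have := Submodule.add_mem_sup huq hv
          rwa [sub_add_eq_add_sub] at this
      have hcomap : (((𝔪 ^ (j + 1) ⊔ J).restrictScalars K).comap
          (ψ.toLinearMap ∘ₗ (homogeneousSubmodule σ K j).subtype)).map
            (homogeneousSubmodule σ K j).subtype = spanDegree Q Finset.univ j := by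
        ext q
        simp only [Submodule.mem_map, mem_spanDegree, Finset.coe_univ, Set.image_univ]
        constructor
        · rintro ⟨⟨q, hq⟩, hqJ, rfl⟩
          exact ⟨h.mem_span_of_map_mem hQ hK hg hq hqJ, hq⟩
        · rintro ⟨hqI, hq⟩
          refine ⟨⟨q, hq⟩, ?_, rfl⟩
          change ψ q ∈ 𝔪 ^ (j + 1) ⊔ J
          rcases lt_or_ge j d with hj | hj
          · have : q ∈ spanDegree Q Finset.univ j := ⟨by simpa using hqI, hq⟩
            rw [spanDegree_of_lt hQ hj, Submodule.mem_bot] at this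
            simp [this]
          · obtain ⟨k, rfl⟩ := Nat.exists_eq_add_of_le' hj
            have : q ∈ spanDegree Q Finset.univ (k + d) := ⟨by simpa using hqI, hq⟩
            obtain ⟨α, hα, rfl⟩ := (mem_spanDegree_add_iff hQ).1 this
            have h2 : ∑ i, ψ (α i) * g i ∈ J :=
              Ideal.sum_mem _ fun i _ => Ideal.mul_mem_left _ _ (Ideal.subset_span ⟨i, rfl⟩)
            have := Submodule.add_mem_sup
              (Ideal.neg_mem_iff _ |>.2 (h.sum_mul_sub_map_mem_pow hg hα)) h2
            rwa [neg_sub, sub_add_cancel] at this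
      rw [← Submodule.finrank_map_subtype_eq, hcomap, ih.2, ← hQ0.finrank_spanDegree hd hQ] at heq
      refine ⟨hfin, ?_⟩
      rw [Finset.sum_range_succ]
      omega
  obtain ⟨M, hM⟩ := h.pow_le_span hQ hQ0 hg
  set N := M + Fintype.card σ * d + 1 with hN
  have := (key N).2
  rwa [sup_eq_right.2 (hM N (by omega)), sum_card_fin_functions d (by omega)] at this

end IsRegularSystem

end LocalStep

section AnalyticGerms

open MvPolynomial Asymptotics

variable {n : ℕ}

/-- The germ at `0` of a function which is analytic at `0`. -/
def analyticGerm (f : En n → ℂ) (hf : AnalyticAt ℂ f 0) : AnalyticGerms n :=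
  ⟨(f : (𝓝 (0 : En n)).Germ ℂ), f, hf, rfl⟩

theorem analyticGerm_surjective (x : AnalyticGerms n) : ∃ f hf, analyticGerm f hf = x := by
  obtain ⟨x, f, hf, rfl⟩ := x
  exact ⟨f, hf, rfl⟩

theorem analyticGerm_eq_iff {f g : En n → ℂ} {hf : AnalyticAt ℂ f 0} {hg : AnalyticAt ℂ g 0} :
    analyticGerm f hf = analyticGerm g hg ↔ f =ᶠ[𝓝 0] g :=
  Subtype.ext_iff.trans Filter.Germ.coe_eq

theorem analyticGerm_add {f g : En n → ℂ} (hf : AnalyticAt ℂ f 0) (hg : AnalyticAt ℂ g 0) :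
    analyticGerm f hf + analyticGerm g hg = analyticGerm (f + g) (hf.add hg) := rfl

theorem analyticGerm_sub {f g : En n → ℂ} (hf : AnalyticAt ℂ f 0) (hg : AnalyticAt ℂ g 0) :
    analyticGerm f hf - analyticGerm g hg = analyticGerm (f - g) (hf.sub hg) := rfl

theorem analyticGerm_mul {f g : En n → ℂ} (hf : AnalyticAt ℂ f 0) (hg : AnalyticAt ℂ g 0) :
    analyticGerm f hf * analyticGerm g hg = analyticGerm (f * g) (hf.mul hg) := rfl

theorem algebraMap_analyticGerms (c : ℂ) :
    algebraMap ℂ (AnalyticGerms n) c = analyticGerm (fun _ => c) analyticAt_const := rfl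

theorem analyticAt_coord (i : Fin n) (z : En n) : AnalyticAt ℂ (fun z : En n => z i) z :=
  (EuclideanSpace.proj i : En n →L[ℂ] ℂ).analyticAt z

theorem analyticAt_evalE (q : MvPolynomial (Fin n) ℂ) (z : En n) : AnalyticAt ℂ (evalE q) z := by
  induction q using MvPolynomial.induction_on with
  | C a => exact (analyticAt_const (v := a)).congr (.of_forall fun z => by simp [evalE])
  | add p q hp hq => exact (hp.add hq).congr (.of_forall fun z => by simp [evalE])
  | mul_X p i hp =>
    exact (hp.mul (analyticAt_coord i z)).congr (.of_forall fun z => by simp [evalE])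

/-- The germ at `0` of a polynomial. -/
def polyGerm (n : ℕ) : MvPolynomial (Fin n) ℂ →ₐ[ℂ] AnalyticGerms n :=
  aeval fun i => analyticGerm (fun z => z i) (analyticAt_coord i 0)

theorem polyGerm_apply (q : MvPolynomial (Fin n) ℂ) :
    polyGerm n q = analyticGerm (evalE q) (analyticAt_evalE q 0) := by
  induction q using MvPolynomial.induction_on with
  | C a =>
    rw [← algebraMap_eq, AlgHom.commutes, algebraMap_analyticGerms, analyticGerm_eq_iff]
    exact .of_eq (by funext z; simp [evalE])
  | add p q hp hq =>
    rw [map_add, hp, hq, analyticGerm_add, analyticGerm_eq_iff]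
    exact .of_eq (by funext z; simp [evalE])
  | mul_X p i hp =>
    rw [map_mul, hp, polyGerm, aeval_X, analyticGerm_mul, analyticGerm_eq_iff]
    exact .of_eq (by funext z; simp [evalE])

/-- The ideal of germs generated by the coordinate functions. -/
def coordIdeal (n : ℕ) : Ideal (AnalyticGerms n) :=
  Ideal.span (Set.range fun i => polyGerm n (X i))

theorem apply_eq_sum_single (L : En n →L[ℂ] ℂ) (v : En n) :
    L v = ∑ i, L (EuclideanSpace.single i 1) * v i := by
  conv_lhs => rw [← (EuclideanSpace.basisFun (Fin n) ℂ).sum_repr v]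
  simp [mul_comm]

theorem exists_eventuallyEq_sum_mul {f : En n → ℂ} (hf : AnalyticAt ℂ f 0) (hf0 : f 0 = 0) :
    ∃ h : Fin n → En n → ℂ, (∀ i, AnalyticAt ℂ (h i) 0) ∧
      f =ᶠ[𝓝 0] fun z => ∑ i, h i z * z i := by
  obtain ⟨p, r, hp⟩ := hf
  have hrad : 0 < p.shift.radius := by
    rw [p.radius_shift]
    exact hp.r_pos.trans_le hp.r_le
  have hs := p.shift.hasFPowerSeriesOnBall hrad
  refine ⟨fun i z => p.shift.sum z (EuclideanSpace.single i 1), fun i => ?_, ?_⟩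
  · exact ((ContinuousLinearMap.apply ℂ ℂ (EuclideanSpace.single i (1 : ℂ) : En n)).analyticAt
      _).comp hs.analyticAt
  · have hball : ∀ᶠ z : En n in 𝓝 0, z ∈ Metric.eball (0 : En n) (min r p.shift.radius) :=
      Metric.eball_mem_nhds 0 (lt_min hp.r_pos hrad)
    filter_upwards [hball] with z hz
    have h1 := hp.hasSum (Metric.eball_subset_eball (min_le_left _ _) hz)
    have h2 := (hs.hasSum (Metric.eball_subset_eball (min_le_right _ _) hz)).mapL
      (ContinuousLinearMap.apply ℂ ℂ z)
    rw [zero_add] at h1 h2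
    have h3 := (hasSum_nat_add_iff' 1).2 h1
    rw [Finset.sum_range_one, hp.coeff_zero, hf0, sub_zero] at h3
    have h4 : f z = p.shift.sum z z := h3.unique (by
      convert h2 using 2 with k
      · simp only [FormalMultilinearSeries.shift, ContinuousLinearMap.apply_apply,
          ContinuousMultilinearMap.curryRight_apply]
        congr 1
        funext i
        refine Fin.lastCases ?_ (fun i => ?_) i <;> simp
      · rfl)
    rw [h4, apply_eq_sum_single]

theorem mem_coordIdeal_iff {f : En n → ℂ} (hf : AnalyticAt ℂ f 0) :
    analyticGerm f hf ∈ coordIdeal n ↔ f 0 = 0 := by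
  constructor
  · intro h
    let ev : AnalyticGerms n →+* ℂ :=
      (Filter.Germ.valueRingHom (X := En n) (x := 0)).comp (AnalyticGerms n).val.toRingHom
    have : coordIdeal n ≤ RingHom.ker ev := by
      rw [coordIdeal, Ideal.span_le]
      rintro _ ⟨i, rfl⟩
      change ev (polyGerm n (X i)) = 0
      rw [polyGerm_apply]
      change evalE (X i) 0 = 0
      simp [evalE]
    exact this h
  · intro h
    obtain ⟨c, hc, hfc⟩ := exists_eventuallyEq_sum_mul hf h
    have : analyticGerm f hf = ∑ i, analyticGerm (c i) (hc i) * polyGerm n (X i) := by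
      refine Subtype.ext ?_
      simp only [polyGerm_apply]
      have hsum : ∀ s : Finset (Fin n),
          ((∑ i ∈ s, analyticGerm (c i) (hc i) * analyticGerm _ (analyticAt_evalE (X i) 0) :
            AnalyticGerms n) : (𝓝 (0 : En n)).Germ ℂ) =
          ((fun z => ∑ i ∈ s, c i z * z i : En n → ℂ) : (𝓝 (0 : En n)).Germ ℂ) := fun s => by
        induction s using Finset.induction_on with
        | empty => simp; rfl
        | insert i s hi ih =>
          rw [Finset.sum_insert hi, Subalgebra.coe_add, ih]
          change (((c i * evalE (X i) + fun z => ∑ i ∈ s, c i z * z i : En n → ℂ)) :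
            (𝓝 (0 : En n)).Germ ℂ) = _
          refine Filter.Germ.coe_eq.2 (.of_eq ?_)
          funext z
          simp [Finset.sum_insert hi, evalE]
      rw [hsum]
      exact Filter.Germ.coe_eq.2 hfc
    rw [this]
    exact Ideal.sum_mem _ fun i _ => Ideal.mul_mem_left _ _ (Ideal.subset_span ⟨i, rfl⟩)

theorem isUnit_analyticGerm {f : En n → ℂ} (hf : AnalyticAt ℂ f 0) (h : f 0 ≠ 0) :
    IsUnit (analyticGerm f hf) := by
  refine IsUnit.of_mul_eq_one (analyticGerm f⁻¹ (hf.inv h)) ?_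
  rw [analyticGerm_mul, ← map_one (algebraMap ℂ (AnalyticGerms n)), algebraMap_analyticGerms,
    analyticGerm_eq_iff]
  filter_upwards [hf.continuousAt.eventually_ne h] with z hz
  simp [hz]

theorem isBigO_of_mem_coordIdeal_pow {k : ℕ} {f : En n → ℂ} {hf : AnalyticAt ℂ f 0}
    (h : analyticGerm f hf ∈ coordIdeal n ^ k) : f =O[𝓝 0] fun z => ‖z‖ ^ k := by
  generalize hx : analyticGerm f hf = x at h
  induction k generalizing x f with
  | zero => simpa using hf.continuousAt.isBigO_one ℝ
  | succ k ih =>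
    rw [pow_succ] at h
    induction h using Submodule.mul_induction_on' generalizing f with
    | mem_mul_mem b hb y hy =>
      obtain ⟨b, hb', rfl⟩ := analyticGerm_surjective b
      obtain ⟨y, hy', rfl⟩ := analyticGerm_surjective y
      rw [analyticGerm_mul, analyticGerm_eq_iff] at hx
      rw [mem_coordIdeal_iff] at hy
      have h1 : y =O[𝓝 0] fun z => ‖z‖ := by
        have := hy'.differentiableAt.isBigO_sub
        simpa [hy] using this.norm_right
      simp only [pow_succ]
      exact hx.trans_isBigO ((ih _ rfl hb).mul h1)
    | add b _ y _ hb hy =>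
      obtain ⟨b, hb', rfl⟩ := analyticGerm_surjective b
      obtain ⟨y, hy', rfl⟩ := analyticGerm_surjective y
      rw [analyticGerm_add, analyticGerm_eq_iff] at hx
      exact hx.trans_isBigO ((hb rfl).add (hy rfl))

theorem eq_zero_of_isBigO_of_smul {k : ℕ} {G : En n → ℂ}
    (hG : ∀ (t : ℂ) z, G (t • z) = t ^ k * G z) (h : G =O[𝓝 0] fun z => ‖z‖ ^ (k + 1)) (z : En n) :
    G z = 0 := by
  have hlim : Filter.Tendsto (fun t : ℂ => t • z) (𝓝[≠] 0) (𝓝 0) := by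
    have : Continuous fun t : ℂ => t • z := by fun_prop
    simpa using (this.tendsto 0).mono_left nhdsWithin_le_nhds
  have h1 : (fun t : ℂ => t ^ k * G z) =O[𝓝[≠] 0] fun t : ℂ => t ^ (k + 1) := by
    have h2 := h.comp_tendsto hlim
    simp only [Function.comp_def, hG, norm_smul, mul_pow] at h2
    refine h2.trans (IsBigO.of_bound (‖z‖ ^ (k + 1)) (.of_forall fun t => ?_))
    simp [mul_comm]
  have h2 : (fun _ : ℂ => G z) =O[𝓝[≠] 0] fun t : ℂ => t := by
    have h3 := (isBigO_refl (fun t : ℂ => (t ^ k)⁻¹) (𝓝[≠] 0)).mul h1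
    refine (h3.congr' ?_ ?_) <;> filter_upwards [self_mem_nhdsWithin] with t ht
    · field_simp [show t ≠ 0 from ht]
    · rw [pow_succ]
      field_simp [show t ≠ 0 from ht]
  have h3 : Filter.Tendsto (fun _ : ℂ => G z) (𝓝[≠] 0) (𝓝 0) :=
    h2.trans_tendsto (Filter.tendsto_id.mono_left nhdsWithin_le_nhds)
  exact tendsto_nhds_unique tendsto_const_nhds h3

theorem evalE_smul {k : ℕ} {q : MvPolynomial (Fin n) ℂ} (hq : q.IsHomogeneous k) (t : ℂ)
    (z : En n) : evalE q (t • z) = t ^ k * evalE q z :=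
  IsHomogeneous.eval_smul_eq hq t fun i => z i

theorem eq_zero_of_evalE_isBigO {k : ℕ} {q : MvPolynomial (Fin n) ℂ} (hq : q.IsHomogeneous k)
    (h : evalE q =O[𝓝 0] fun z => ‖z‖ ^ (k + 1)) : q = 0 :=
  MvPolynomial.funext fun v => by
    simpa [evalE] using eq_zero_of_isBigO_of_smul (evalE_smul hq) h (WithLp.toLp 2 v)

theorem isRegularSystem_polyGerm (n : ℕ) : IsRegularSystem (polyGerm n) (coordIdeal n) where
  eq_span := rfl
  exists_const x := by
    obtain ⟨f, hf, rfl⟩ := analyticGerm_surjective x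
    refine ⟨f 0, ?_⟩
    rw [algebraMap_analyticGerms, analyticGerm_sub, mem_coordIdeal_iff]
    simp
  eq_zero_of_mem hq h := by
    rw [polyGerm_apply] at h
    exact eq_zero_of_evalE_isBigO hq (isBigO_of_mem_coordIdeal_pow h)
  le_jacobson x hx := by
    rw [Ideal.mem_jacobson_bot]
    intro y
    obtain ⟨f, hf, rfl⟩ := analyticGerm_surjective x
    obtain ⟨g, hg, rfl⟩ := analyticGerm_surjective y
    rw [mem_coordIdeal_iff] at hx
    rw [← map_one (algebraMap ℂ (AnalyticGerms n)), algebraMap_analyticGerms, analyticGerm_mul,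
      analyticGerm_add]
    exact isUnit_analyticGerm _ (by simp [hx])

theorem mem_coordIdeal_pow_iff {k : ℕ} {f : En n → ℂ} (hf : AnalyticAt ℂ f 0) :
    analyticGerm f hf ∈ coordIdeal n ^ k ↔ f =O[𝓝 0] fun z => ‖z‖ ^ k := by
  refine ⟨isBigO_of_mem_coordIdeal_pow, fun h => ?_⟩
  have hle : ∀ l, (fun z : En n => ‖z‖ ^ (l + 1)) =O[𝓝 0] fun z => ‖z‖ ^ l := fun l => by
    have h1 : (fun z : En n => ‖z‖) =O[𝓝 0] fun _ => (1 : ℝ) :=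
      continuous_norm.continuousAt.isBigO_one ℝ
    simpa [pow_succ] using (isBigO_refl (fun z : En n => ‖z‖ ^ l) (𝓝 0)).mul h1
  induction k with
  | zero => simp
  | succ k ih =>
    obtain ⟨q, hq, hfq⟩ := (isRegularSystem_polyGerm n).exists_isHomogeneous (ih (h.trans (hle k)))
    have h1 := hfq
    rw [polyGerm_apply, analyticGerm_sub] at h1
    have h2 : evalE q =O[𝓝 0] fun z => ‖z‖ ^ (k + 1) := by
      simpa using h.sub (isBigO_of_mem_coordIdeal_pow h1)
    rwa [eq_zero_of_evalE_isBigO hq h2, map_zero, sub_zero] at hfq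

theorem analyticAt_partial {f : En n → ℂ} (hf : AnalyticAt ℂ f 0) (i : Fin n) :
    AnalyticAt ℂ (fun z => fderiv ℂ f z (EuclideanSpace.single i 1)) 0 :=
  ((ContinuousLinearMap.apply ℂ ℂ (EuclideanSpace.single i (1 : ℂ) : En n)).analyticAt _).comp
    hf.fderiv

theorem eventually_fderiv_mul {f g : En n → ℂ} (hf : AnalyticAt ℂ f 0) (hg : AnalyticAt ℂ g 0)
    (v : En n) : (fun z => fderiv ℂ (f * g) z v) =ᶠ[𝓝 0]
      (f * fun z => fderiv ℂ g z v) + (fun z => fderiv ℂ f z v) * g := by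
  filter_upwards [hf.eventually_analyticAt, hg.eventually_analyticAt] with z hfz hgz
  rw [fderiv_mul hfz.differentiableAt hgz.differentiableAt]
  simp [mul_comm]

theorem partial_mem_coordIdeal_pow {k : ℕ} {f : En n → ℂ} (hf : AnalyticAt ℂ f 0)
    (h : analyticGerm f hf ∈ coordIdeal n ^ (k + 1)) (i : Fin n) :
    analyticGerm _ (analyticAt_partial hf i) ∈ coordIdeal n ^ k := by
  generalize hx : analyticGerm f hf = x at h
  induction k generalizing x f with
  | zero => simp
  | succ k ih =>
    rw [pow_succ] at h
    induction h using Submodule.mul_induction_on' generalizing f with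
    | mem_mul_mem b hb y hy =>
      obtain ⟨b, hb', rfl⟩ := analyticGerm_surjective b
      obtain ⟨y, hy', rfl⟩ := analyticGerm_surjective y
      rw [analyticGerm_mul, analyticGerm_eq_iff] at hx
      have h1 : analyticGerm _ (analyticAt_partial hf i) =
          analyticGerm b hb' * analyticGerm _ (analyticAt_partial hy' i) +
            analyticGerm _ (analyticAt_partial hb' i) * analyticGerm y hy' := by
        rw [analyticGerm_mul, analyticGerm_mul, analyticGerm_add, analyticGerm_eq_iff]
        refine Filter.EventuallyEq.trans ?_ (eventually_fderiv_mul hb' hy' _)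
        filter_upwards [hx.fderiv (𝕜 := ℂ)] with z hz
        rw [hz]
      rw [h1]
      refine Ideal.add_mem _ (Ideal.mul_mem_right _ _ hb) ?_
      rw [pow_succ]
      exact Ideal.mul_mem_mul (ih hb' _ rfl hb) hy
    | add b _ y _ hb hy =>
      obtain ⟨b, hb', rfl⟩ := analyticGerm_surjective b
      obtain ⟨y, hy', rfl⟩ := analyticGerm_surjective y
      rw [analyticGerm_add, analyticGerm_eq_iff] at hx
      have h1 : analyticGerm _ (analyticAt_partial hf i) =
          analyticGerm _ (analyticAt_partial hb' i) + analyticGerm _ (analyticAt_partial hy' i) := by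
        rw [analyticGerm_add, analyticGerm_eq_iff]
        filter_upwards [hx.fderiv (𝕜 := ℂ), hb'.eventually_analyticAt,
          hy'.eventually_analyticAt] with z hz hbz hyz
        rw [hz, fderiv_add hbz.differentiableAt hyz.differentiableAt]
        rfl
      rw [h1]
      exact Ideal.add_mem _ (hb hb' rfl) (hy hy' rfl)

theorem fderiv_evalE (q : MvPolynomial (Fin n) ℂ) (z : En n) (i : Fin n) :
    fderiv ℂ (evalE q) z (EuclideanSpace.single i 1) = evalE (pderiv i q) z := by
  have hd : ∀ q : MvPolynomial (Fin n) ℂ, DifferentiableAt ℂ (evalE q) z := fun q =>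
    (analyticAt_evalE q z).differentiableAt
  induction q using MvPolynomial.induction_on with
  | C a =>
    have : evalE (C a : MvPolynomial (Fin n) ℂ) = fun _ => a := by funext z; simp [evalE]
    rw [this]
    simp [evalE]
  | add p q hp hq =>
    have : evalE (p + q) = evalE p + evalE q := by funext z; simp [evalE]
    rw [this, fderiv_add (hd p) (hd q), _root_.add_apply, hp, hq]
    simp [evalE]
  | mul_X p j hp =>
    have h1 : evalE (p * X j) = evalE p * evalE (X j) := by funext z; simp [evalE]
    have h2 : evalE (X j : MvPolynomial (Fin n) ℂ) =
        (EuclideanSpace.proj j : En n →L[ℂ] ℂ) := by funext z; simp [evalE]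
    have h3 : fderiv ℂ (evalE (X j : MvPolynomial (Fin n) ℂ)) z (EuclideanSpace.single i 1) =
        if j = i then 1 else 0 := by
      rw [h2, ContinuousLinearMap.fderiv]
      simp
    rw [h1, fderiv_mul (hd p) (hd _)]
    simp only [_root_.add_apply, _root_.smul_apply, hp, h3, smul_eq_mul]
    simp [evalE, pderiv_X, Pi.single_apply, eq_comm, apply_ite, mul_comm]

theorem HasInitialTerm.exists_isHomogeneous {f : En n → ℂ} (hf : AnalyticAt ℂ f 0) {m : ℕ}
    {P : En n → ℂ} (h : HasInitialTerm f m P) :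
    ∃ F : MvPolynomial (Fin n) ℂ, F.IsHomogeneous m ∧ P = evalE F ∧
      analyticGerm f hf - polyGerm n F ∈ coordIdeal n ^ (m + 1) := by
  obtain ⟨p, hp, hlow, hPp, -⟩ := h
  have hfP : (fun z => f z - P z) =O[𝓝 0] fun z => ‖z‖ ^ (m + 1) := by
    have := hp.isBigO_sub_partialSum_pow (m + 1)
    refine this.congr_left fun z => ?_
    rw [zero_add, FormalMultilinearSeries.partialSum, Finset.sum_range_succ, hPp,
      Finset.sum_eq_zero fun k hk => hlow k (Finset.mem_range.1 hk) z, zero_add]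
  have hPsmul : ∀ (t : ℂ) z, P (t • z) = t ^ m * P z := fun t z => by
    rw [hPp, hPp, ← smul_eq_mul, ContinuousMultilinearMap.map_smul_univ (p m) (fun _ => t)]
    simp
  have hPO : P =O[𝓝 0] fun z => ‖z‖ ^ m := IsBigO.of_bound ‖p m‖ (.of_forall fun z => by
    rw [hPp]
    simpa using (p m).le_opNorm fun _ => z)
  have hle : (fun z : En n => ‖z‖ ^ (m + 1)) =O[𝓝 0] fun z => ‖z‖ ^ m := by
    have h1 : (fun z : En n => ‖z‖) =O[𝓝 0] fun _ => (1 : ℝ) :=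
      continuous_norm.continuousAt.isBigO_one ℝ
    simpa [pow_succ] using (isBigO_refl (fun z : En n => ‖z‖ ^ m) (𝓝 0)).mul h1
  have hfO : f =O[𝓝 0] fun z => ‖z‖ ^ m := by
    simpa using (hfP.trans hle).add hPO
  obtain ⟨F, hF, hfF⟩ := (isRegularSystem_polyGerm n).exists_isHomogeneous
    ((mem_coordIdeal_pow_iff hf).2 hfO)
  refine ⟨F, hF, ?_, hfF⟩
  rw [polyGerm_apply, analyticGerm_sub] at hfF
  have h1 : (fun z => P z - evalE F z) =O[𝓝 0] fun z => ‖z‖ ^ (m + 1) := by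
    refine ((isBigO_of_mem_coordIdeal_pow hfF).sub hfP).congr_left fun z => ?_
    simp
  funext z
  exact sub_eq_zero.1 (eq_zero_of_isBigO_of_smul (fun t z => by
    rw [hPsmul, evalE_smul hF, mul_sub]) h1 z)

theorem jacobianIdeal_eq {f : En n → ℂ} (hf : AnalyticAt ℂ f 0) :
    jacobianIdeal f =
      Ideal.span (Set.range fun i => analyticGerm _ (analyticAt_partial hf i)) := by
  rw [jacobianIdeal]
  congr 1
  ext g
  exact exists_congr fun i => ⟨fun h => Subtype.ext h.symm, fun h => h ▸ rfl⟩

theorem fderiv_eq_zero_of_partial {P : En n → ℂ} {z : En n}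
    (h : ∀ i, fderiv ℂ P z (EuclideanSpace.single i 1) = 0) : fderiv ℂ P z = 0 := by
  ext v
  rw [apply_eq_sum_single]
  simp [h]

end AnalyticGerms

theorem milnor_eq_of_isolated_initial {n : ℕ}
    (f : En n → ℂ) (hf : AnalyticAt ℂ f 0) (hf0 : f 0 = 0)
    -- `f` has algebraic multiplicity `m` with initial homogeneous term `P`
    (m : ℕ) (P : En n → ℂ) (hfi : HasInitialTerm f m P)
    -- the partial derivatives of `P` have no common zero other than `0`
    (hP : ∀ z : En n, fderiv ℂ P z = 0 → z = 0) :
    milnorNumber f = (m - 1) ^ n := by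
  obtain ⟨F, hF, rfl, hfF⟩ := hfi.exists_isHomogeneous hf
  have hP0 : evalE F ≠ 0 := by
    obtain ⟨-, -, -, -, h⟩ := hfi
    exact h
  have hm : m ≠ 0 := by
    rintro rfl
    obtain ⟨p, hp, -, hpP, hne⟩ := hfi
    exact hne (funext fun z => by rw [hpP, hp.coeff_zero, hf0, Pi.zero_apply])
  set Q : Fin n → MvPolynomial (Fin n) ℂ := fun i => MvPolynomial.pderiv i F with hQdef
  have hQ : ∀ i, (Q i).IsHomogeneous (m - 1) := fun i => hF.pderiv
  have hg : ∀ i, analyticGerm _ (analyticAt_partial hf i) - polyGerm n (Q i) ∈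
      coordIdeal n ^ (m - 1 + 1) := fun i => by
    rw [Nat.sub_add_cancel (Nat.one_le_iff_ne_zero.2 hm)]
    rw [polyGerm_apply, analyticGerm_sub] at hfF
    have h := partial_mem_coordIdeal_pow _ hfF i
    convert h using 1
    rw [polyGerm_apply, analyticGerm_sub, analyticGerm_eq_iff]
    filter_upwards [hf.eventually_analyticAt] with z hz
    rw [fderiv_sub hz.differentiableAt (analyticAt_evalE F z).differentiableAt]
    simp [hQdef, fderiv_evalE]
  have hgrad : ∀ z : En n, (∀ i, evalE (Q i) z = 0) → z = 0 := fun z hz =>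
    hP z (fderiv_eq_zero_of_partial fun i => by rw [fderiv_evalE, hz])
  rw [milnorNumber, jacobianIdeal_eq hf]
  rcases (m - 1).eq_zero_or_pos with hd | hd
  · obtain ⟨z, hz⟩ := Function.ne_iff.1 hP0
    have hz0 : z ≠ 0 := by
      rintro rfl
      have := evalE_smul hF 0 (0 : En n)
      rw [zero_smul, zero_pow hm, zero_mul] at this
      exact hz this
    obtain ⟨i, hi⟩ : ∃ i, evalE (Q i) z ≠ 0 := by
      by_contra! h
      exact hz0 (hgrad z h)
    have hi0 : evalE (Q i) 0 ≠ 0 := by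
      have := evalE_smul (hQ i) 0 z
      rw [hd, pow_zero, one_mul, zero_smul] at this
      rwa [this]
    have hgi := hg i
    rw [hd, zero_add, pow_one, polyGerm_apply, analyticGerm_sub, mem_coordIdeal_iff, Pi.sub_apply,
      sub_eq_zero] at hgi
    have htop := Ideal.eq_top_of_isUnit_mem
      (Ideal.span (Set.range fun i => analyticGerm _ (analyticAt_partial hf i)))
      (Ideal.subset_span ⟨i, rfl⟩) (isUnit_analyticGerm (analyticAt_partial hf i) (hgi ▸ hi0))
    rw [htop, hd, zero_pow (Nat.pos_iff_ne_zero.1 (Fin.pos i))]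
    have : Subsingleton (AnalyticGerms n ⧸ (⊤ : Ideal (AnalyticGerms n))) :=
      Ideal.Quotient.subsingleton_iff.2 rfl
    exact Module.finrank_zero_of_subsingleton
  · have := (isRegularSystem_polyGerm n).finrank_quotient_eq hd hQ
      (fun v hv => by
        have := hgrad (WithLp.toLp 2 v) hv
        simpa using this) hg
    rwa [Fintype.card_fin] at this
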